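/- For every N ≥ 2, every θ ∈ (0, π/2], ã > 0, d > 0, and every triple r, p, α with 1 ≤ p ≤ r ≤ Np/(N − p(1−α)), p(1−α) < N and 0 ≤ α ≤ 1, there exists a constant C > 0, depending only on N, r, p, α, θ, ã and d, such that the following holds: for every bounded domain Ω ⊂ ℝ^N with diameter at most d satisfying the (θ,ã)-uniform interior cone condition and every torsion function u on Ω which is C¹ up to the boundary, the function h(x) := |x−z|²/2 − u(x), with z the barycenter of Ω, satisfies (∫_Ω |∇h|^r dx)^{1/r} ≤ C (∫_Ω dist(x,∂Ω)^{αp} |∇²h|^p dx)^{1/p}. -/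

import Mathlib

open MeasureTheory Metric Set Real RealInnerProductSpace

noncomputable section

/-- Euclidean space `ℝ^N`. -/
abbrev Euc (N : ℕ) : Type := EuclideanSpace ℝ (Fin N)

/-- The `(i,j)` entry of the Hessian matrix of `u` at `x`. -/
def hessEntry {N : ℕ} (u : Euc N → ℝ) (x : Euc N) (i j : Fin N) : ℝ :=
  fderiv ℝ (fun y => fderiv ℝ u y (EuclideanSpace.single j (1 : ℝ))) x
    (EuclideanSpace.single i (1 : ℝ))

/-- Squared Frobenius norm of the Hessian of `u` at `x`. -/
def hessNormSq {N : ℕ} (u : Euc N → ℝ) (x : Euc N) : ℝ :=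
  ∑ i, ∑ j, (hessEntry u x i j) ^ 2

/-- The Laplacian of `u` at `x` (trace of the Hessian). -/
def lap {N : ℕ} (u : Euc N → ℝ) (x : Euc N) : ℝ := ∑ i, hessEntry u x i i

/-- `u` is a torsion function on `Ω`: continuous on the closure, `C²` inside,
`Δu = N` in `Ω` and `u = 0` on `∂Ω`. -/
def IsTorsion {N : ℕ} (Ω : Set (Euc N)) (u : Euc N → ℝ) : Prop :=
  ContinuousOn u (closure Ω) ∧ ContDiffOn ℝ 2 u Ω ∧
    (∀ x ∈ Ω, lap u x = N) ∧ ∀ x ∈ frontier Ω, u x = 0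

/-- `G` is a `b₀`-John domain. -/
def IsJohn {N : ℕ} (b₀ : ℝ) (G : Set (Euc N)) : Prop :=
  ∀ a ∈ G, ∀ b ∈ G, a ≠ b → ∃ γ : ℝ → Euc N,
    ContinuousOn γ (Icc 0 1) ∧ γ 0 = a ∧ γ 1 = b ∧ (∀ t ∈ Icc (0:ℝ) 1, γ t ∈ G) ∧
    ∀ t ∈ Icc (0:ℝ) 1, b₀⁻¹ * min (dist (γ t) a) (dist (γ t) b) ≤ infDist (γ t) (frontier G)

/-- `(θ, a)`-uniform interior cone condition. -/
def UnifConeCond {N : ℕ} (θ a : ℝ) (G : Set (Euc N)) : Prop :=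
  ∀ x ∈ frontier G, ∃ ω : Euc N, ‖ω‖ = 1 ∧
    ∀ w ∈ ball x a ∩ closure G, ∀ y : Euc N,
      ⟪y, ω⟫ > ‖y‖ * Real.cos θ → ‖y‖ < a → w + y ∈ G

/-- `r`-uniform interior sphere condition. -/
def IntSphere {N : ℕ} (r : ℝ) (Ω : Set (Euc N)) : Prop :=
  ∀ x ∈ frontier Ω, ∃ c : Euc N, ball c r ⊆ Ω ∧ dist x c = r

/-- `r`-uniform exterior sphere condition. -/
def ExtSphere {N : ℕ} (r : ℝ) (Ω : Set (Euc N)) : Prop :=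
  ∀ x ∈ frontier Ω, ∃ c : Euc N, ball c r ⊆ (closure Ω)ᶜ ∧ dist x c = r

section Geometry

variable {N : ℕ} {Ω : Set (Euc N)}

lemma ball_infDist_frontier_subset (hΩ : IsOpen Ω) {x : Euc N} (hx : x ∈ Ω) :
    ball x (infDist x (frontier Ω)) ⊆ Ω := by
  rcases (infDist_nonneg (x := x) (s := frontier Ω)).eq_or_lt with h0 | h0
  · simp [← h0]
  refine (convex_ball x _).isPreconnected.subset_of_closure_inter_subset hΩ
    ⟨x, mem_ball_self h0, hx⟩ ?_
  rintro y ⟨hy, hyb⟩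
  by_contra hyΩ
  have hyf : y ∈ frontier Ω := by
    rw [hΩ.frontier_eq]
    exact ⟨hy, hyΩ⟩
  exact notMem_of_dist_lt_infDist (mem_ball'.1 hyb) hyf

lemma le_infDist_frontier (hΩ : IsOpen Ω) (hf : (frontier Ω).Nonempty) {x : Euc N} {s : ℝ}
    (h : ball x s ⊆ Ω) : s ≤ infDist x (frontier Ω) := by
  rw [le_infDist hf]
  intro y hy
  by_contra! hlt
  rw [hΩ.frontier_eq] at hy
  exact hy.2 (h (mem_ball'.2 hlt))

lemma infDist_frontier_pos (hΩ : IsOpen Ω) (hf : (frontier Ω).Nonempty) {x : Euc N}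
    (hx : x ∈ Ω) : 0 < infDist x (frontier Ω) := by
  obtain ⟨ε, hε, hb⟩ := Metric.isOpen_iff.1 hΩ x hx
  exact hε.trans_le (le_infDist_frontier hΩ hf hb)

lemma infDist_frontier_le_diam (hf : (frontier Ω).Nonempty) (hb : Bornology.IsBounded Ω)
    {x : Euc N} (hx : x ∈ Ω) : infDist x (frontier Ω) ≤ diam Ω := by
  obtain ⟨y, hy⟩ := hf
  refine (infDist_le_dist_of_mem hy).trans ?_
  rw [← diam_closure]
  exact dist_le_diam_of_mem hb.closure (subset_closure hx) (frontier_subset_closure hy)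

lemma frontier_nonempty_of_isBounded (hN : 2 ≤ N) (hne : Ω.Nonempty)
    (hb : Bornology.IsBounded Ω) : (frontier Ω).Nonempty := by
  have : NeZero N := ⟨by omega⟩
  rw [nonempty_frontier_iff]
  refine ⟨hne, ?_⟩
  rintro rfl
  exact NormedSpace.unbounded_univ ℝ (Euc N) hb

/-- Translating a point of `Ω` near `w₀` by `t • e` produces a point of depth at least `t * σ`. -/
def InwardShift (Ω : Set (Euc N)) (R σ : ℝ) (w₀ e : Euc N) : Prop :=
  ∀ z ∈ Ω, dist z w₀ < R → ∀ t ∈ Icc (0 : ℝ) 1, ball (z + t • e) (t * σ) ⊆ Ω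

lemma InwardShift.mem {R σ : ℝ} {w₀ e z : Euc N} (h : InwardShift Ω R σ w₀ e) (hσ : 0 < σ)
    (hz : z ∈ Ω) (hd : dist z w₀ < R) {t : ℝ} (ht : t ∈ Icc (0 : ℝ) 1) : z + t • e ∈ Ω := by
  rcases ht.1.eq_or_lt with h0 | h0
  · simpa [← h0] using hz
  · exact h z hz hd t ht (mem_ball_self (by positivity))

lemma UnifConeCond.exists_inwardShift {θ a : ℝ} (hθ : θ ∈ Ioc (0 : ℝ) (π / 2)) (ha : 0 < a)
    (hΩ : IsOpen Ω) (hf : (frontier Ω).Nonempty) (hc : UnifConeCond θ a Ω) {w₀ : Euc N}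
    (hw : w₀ ∈ Ω) :
    ∃ e : Euc N, ‖e‖ ≤ a / 16 ∧ InwardShift Ω (a / 4) (a / 32 * (1 - cos θ)) w₀ e := by
  have hcos0 : 0 ≤ cos θ := cos_nonneg_of_mem_Icc ⟨by linarith [hθ.1, pi_pos], hθ.2⟩
  have hcos1 : cos θ < 1 := by
    rw [← cos_zero]
    exact cos_lt_cos_of_nonneg_of_le_pi_div_two le_rfl hθ.2 hθ.1
  set σ := a / 32 * (1 - cos θ) with hσ
  have hσ0 : 0 < σ := mul_pos (by positivity) (by linarith)
  have hσ1 : σ ≤ a / 32 := by nlinarith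
  by_cases hdeep : a / 4 + σ ≤ infDist w₀ (frontier Ω)
  · refine ⟨0, by simp; positivity, fun z _ hzw t ht y hy => ?_⟩
    refine ball_infDist_frontier_subset hΩ hw (mem_ball.2 ?_)
    have h1 : dist y z < t * σ := by simpa using hy
    have h2 : t * σ ≤ σ := by nlinarith [ht.2]
    linarith [dist_triangle y z w₀]
  · obtain ⟨x, hx, hxw⟩ := (infDist_lt_iff hf).1 (not_le.1 hdeep)
    obtain ⟨ω, hω, hcone⟩ := hc x hx
    refine ⟨(a / 16) • ω, by rw [norm_smul, hω, norm_eq_abs, abs_of_pos (by positivity), mul_one],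
      fun z hz hzw t ht y hy => ?_⟩
    have hzx : dist z x < a := by linarith [dist_triangle z w₀ x]
    have h0t : 0 < t := by
      by_contra! h
      have : t * σ ≤ 0 := mul_nonpos_of_nonpos_of_nonneg h hσ0.le
      exact absurd (mem_ball.1 hy) (not_lt.2 (this.trans dist_nonneg))
    have hη : ‖y - (z + t • (a / 16) • ω)‖ < t * σ := by simpa [dist_eq_norm] using hy
    set η := y - (z + t • (a / 16) • ω) with hηdef
    have hy' : y - z = (t * (a / 16)) • ω + η := by rw [hηdef, mul_smul]; abel
    have hin : ⟪y - z, ω⟫ ≥ t * (a / 16) - ‖η‖ := by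
      rw [hy', inner_add_left, real_inner_smul_left, real_inner_self_eq_norm_sq, hω]
      have := abs_real_inner_le_norm η ω
      rw [hω, mul_one] at this
      linarith [neg_abs_le ⟪η, ω⟫]
    have hnorm : ‖y - z‖ ≤ t * (a / 16) + ‖η‖ := by
      rw [hy']
      refine (norm_add_le _ _).trans ?_
      rw [norm_smul, hω, norm_eq_abs, abs_of_pos (by positivity), mul_one]
    have htσ : t * σ ≤ σ := by nlinarith [ht.2]
    have hta : t * (a / 16) ≤ a / 16 := by nlinarith [ht.2]
    have := hcone z ⟨hzx, subset_closure hz⟩ (y - z) ?_ (by linarith)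
    · simpa using this
    · have h3 : ‖y - z‖ * cos θ ≤ (t * (a / 16) + ‖η‖) * cos θ :=
        mul_le_mul_of_nonneg_right hnorm hcos0
      have h4 : ‖η‖ * (1 + cos θ) < t * σ * 2 := by nlinarith [norm_nonneg η]
      have h5 : t * σ * 2 = t * (a / 16) * (1 - cos θ) := by rw [hσ]; ring
      nlinarith

/-- The points of `Ω` of depth at least `σ`. -/
def deepSet (Ω : Set (Euc N)) (σ : ℝ) : Set (Euc N) := {z | ball z σ ⊆ Ω}

lemma joinedIn_deepSet_of_segment {σ : ℝ} {x y : Euc N}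
    (h : ∀ t ∈ Icc (0 : ℝ) 1, x + t • (y - x) ∈ deepSet Ω σ) : JoinedIn (deepSet Ω σ) x y := by
  refine JoinedIn.ofLine (f := fun t : ℝ => x + t • (y - x)) (by fun_prop) (by simp) (by simp) ?_
  rintro _ ⟨t, ht, rfl⟩
  exact h t ht

lemma InwardShift.add_mem_deepSet {R σ : ℝ} {w₀ e z : Euc N} (h : InwardShift Ω R σ w₀ e)
    (hz : z ∈ Ω) (hd : dist z w₀ < R) : z + e ∈ deepSet Ω σ := by
  simpa [deepSet] using h z hz hd 1 (by simp)

lemma joinedIn_add_add {R σ : ℝ} (hσ : 0 < σ) {w₁ e₁ w₂ e₂ w : Euc N}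
    (h₁ : InwardShift Ω R σ w₁ e₁) (h₂ : InwardShift Ω R σ w₂ e₂) (hw : w ∈ Ω)
    (hw₁ : dist w w₁ < R / 2) (hw₂ : dist w w₂ < R / 2) (he₁ : ‖e₁‖ ≤ R / 4) (he₂ : ‖e₂‖ ≤ R / 4)
    (hσR : σ ≤ R / 8) : JoinedIn (deepSet Ω σ) (w + e₁) (w + e₂) := by
  have hR : 0 < R := by linarith
  have key : ∀ {w₁ e₁ w₂ e₂ : Euc N}, InwardShift Ω R σ w₁ e₁ → InwardShift Ω R σ w₂ e₂ →
      dist w w₁ < R / 2 → dist w w₂ < R / 2 → ‖e₁‖ ≤ R / 4 →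
      JoinedIn (deepSet Ω σ) (w + e₁) (w + e₁ + e₂) := by
    intro w₁ e₁ w₂ e₂ h₁ h₂ hw₁ hw₂ he₁
    refine joinedIn_deepSet_of_segment fun t ht y hy => ?_
    have hy' : y - t • e₂ ∈ ball (w + e₁) σ := by
      rw [mem_ball, dist_eq_norm] at hy ⊢
      convert hy using 2
      rw [add_sub_cancel_left]
      abel
    have hmem : y - t • e₂ ∈ Ω := h₁.add_mem_deepSet hw (by linarith) hy'
    have hdist : dist (y - t • e₂) w₂ < R := by
      have h3 : dist (w + e₁) w = ‖e₁‖ := by simp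
      linarith [dist_triangle (y - t • e₂) (w + e₁) w₂, dist_triangle (w + e₁) w w₂,
        mem_ball.1 hy']
    simpa using h₂.mem hσ hmem hdist ht
  refine (key h₁ h₂ hw₁ hw₂ he₁).trans ?_
  have := (key h₂ h₁ hw₂ hw₁ he₂).symm
  rwa [add_right_comm] at this

lemma exists_joinedIn_deepSet {R σ : ℝ} (hσ : 0 < σ) (hσR : σ ≤ R / 8) (hΩ : IsOpen Ω)
    (hc : IsConnected Ω)
    (hs : ∀ w₀ ∈ Ω, ∃ e : Euc N, ‖e‖ ≤ R / 4 ∧ InwardShift Ω R σ w₀ e) :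
    ∃ m ∈ deepSet Ω σ, ∀ w₀ ∈ Ω, ∀ e : Euc N, ‖e‖ ≤ R / 4 → InwardShift Ω R σ w₀ e →
      ∀ w ∈ Ω, dist w w₀ < R / 2 → JoinedIn (deepSet Ω σ) m (w + e) := by
  have hR : 0 < R := by linarith
  choose! e he hshift using hs
  have hglob : ∀ w ∈ Ω, ∀ w' ∈ Ω, JoinedIn (deepSet Ω σ) (w + e w) (w' + e w') := by
    intro w hw w' hw'
    refine hc.isPreconnected.induction₂
      (fun w w' => JoinedIn (deepSet Ω σ) (w + e w) (w' + e w')) ?_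
      (fun _ _ _ _ _ _ => JoinedIn.trans) (fun _ _ _ _ => JoinedIn.symm) hw hw'
    intro x hx
    obtain ⟨ε, hε, hball⟩ := Metric.isOpen_iff.1 hΩ x hx
    refine mem_nhdsWithin_of_mem_nhds (Filter.mem_of_superset
      (ball_mem_nhds x (lt_min hε (half_pos hR))) fun y hy => ?_)
    have hyε : dist y x < ε := (mem_ball.1 hy).trans_le (min_le_left _ _)
    have hyR : dist y x < R / 2 := (mem_ball.1 hy).trans_le (min_le_right _ _)
    have hyΩ : y ∈ Ω := hball hyε
    refine (joinedIn_add_add hσ (hshift x hx) (hshift y hyΩ) hx (by simpa using half_pos hR)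
      (by rwa [dist_comm]) (he x hx) (he y hyΩ) hσR).trans ?_
    refine joinedIn_deepSet_of_segment fun t ht => ?_
    have hseg : dist (x + t • (y - x)) x ≤ dist y x := by
      rw [dist_eq_norm, dist_eq_norm, add_sub_cancel_left, norm_smul, norm_eq_abs,
        abs_of_nonneg ht.1]
      exact mul_le_of_le_one_left (norm_nonneg _) ht.2
    have hmem : x + t • (y - x) ∈ Ω := hball (hseg.trans_lt hyε)
    have := (hshift y hyΩ).add_mem_deepSet hmem
      (by linarith [dist_triangle (x + t • (y - x)) x y, dist_comm x y])
    convert this using 1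
    rw [add_sub_add_right_eq_sub]
    abel
  obtain ⟨x₀, hx₀⟩ := hc.nonempty
  refine ⟨x₀ + e x₀, (hshift x₀ hx₀).add_mem_deepSet hx₀ (by simpa using hR), ?_⟩
  intro w₀ hw₀ e' he' hs' w hw hd
  exact (hglob x₀ hx₀ w hw).trans (joinedIn_add_add hσ (hshift w hw) hs' hw
    (by simpa using half_pos hR) hd (he w hw) he' hσR)

end Geometry

section MeanValue

variable {N : ℕ} {Ω : Set (Euc N)}

/-- `F` satisfies the mean value property in `Ω` with respect to the weight `1 - ‖y‖ ^ 2`. -/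
def HasMeanValue (Ω : Set (Euc N)) (F : Euc N → ℝ) : Prop :=
  ∀ x : Euc N, ∀ s : ℝ, 0 ≤ s → closedBall x s ⊆ Ω →
    ∫ y in closedBall (0 : Euc N) 1, (1 - ‖y‖ ^ 2) * F (x + s • y) =
      (∫ y in closedBall (0 : Euc N) 1, (1 - ‖y‖ ^ 2)) * F x

lemma add_smul_mem_closedBall {x y : Euc N} {s : ℝ} (hy : y ∈ closedBall (0 : Euc N) 1) :
    x + s • y ∈ closedBall x |s| := by
  rw [mem_closedBall, dist_eq_norm, add_sub_cancel_left, norm_smul, norm_eq_abs]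
  exact mul_le_of_le_one_right (abs_nonneg _) (by simpa using hy)

lemma hasDerivAt_integral_translate {F : Euc N → ℝ} (hΩ : IsOpen Ω) (hF : ContDiffOn ℝ 1 F Ω)
    {a b : Euc N → Euc N} (ha : Continuous a) (hb : Continuous b)
    (hab : MapsTo a (closedBall 0 1) Ω) :
    HasDerivAt (fun t : ℝ => ∫ y in closedBall (0 : Euc N) 1, (1 - ‖y‖ ^ 2) * F (a y + t • b y))
      (∫ y in closedBall (0 : Euc N) 1, (1 - ‖y‖ ^ 2) * fderiv ℝ F (a y) (b y)) 0 := by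
  have hK : IsCompact (closedBall (0 : Euc N) 1) := isCompact_closedBall _ _
  have hS : IsCompact (a '' closedBall (0 : Euc N) 1) := hK.image ha
  obtain ⟨δ, hδ, hsub⟩ := hS.exists_cthickening_subset_open hΩ hab.image_subset
  have hcomp := hS.cthickening (r := δ)
  have hDF : ContinuousOn (fderiv ℝ F) Ω := hF.continuousOn_fderiv_of_isOpen hΩ le_rfl
  obtain ⟨M, hM⟩ := hcomp.exists_bound_of_continuousOn (hDF.mono hsub)
  obtain ⟨B, hB⟩ := hK.exists_bound_of_continuousOn hb.continuousOn
  have hB0 : 0 ≤ B := (norm_nonneg _).trans (hB 0 (by simp))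
  have hM0 : 0 ≤ M := (norm_nonneg _).trans
    (hM (a 0) (self_subset_cthickening _ (mem_image_of_mem a (by simp))))
  have hmem : ∀ t ∈ ball (0 : ℝ) (δ / (B + 1)), ∀ y ∈ closedBall (0 : Euc N) 1,
      a y + t • b y ∈ cthickening δ (a '' closedBall (0 : Euc N) 1) := by
    intro t ht y hy
    refine mem_cthickening_of_dist_le _ (a y) _ _ (mem_image_of_mem a hy) ?_
    rw [dist_eq_norm, add_sub_cancel_left, norm_smul]
    have h1 : ‖t‖ < δ / (B + 1) := by simpa using ht
    have h2 : ‖t‖ * (B + 1) < δ := (lt_div_iff₀ (by positivity)).1 h1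
    nlinarith [hB y hy, norm_nonneg t, norm_nonneg (b y)]
  have hcont : ∀ t ∈ ball (0 : ℝ) (δ / (B + 1)),
      ContinuousOn (fun y => (1 - ‖y‖ ^ 2) * F (a y + t • b y)) (closedBall 0 1) := by
    intro t ht
    refine ContinuousOn.mul (by fun_prop) (hF.continuousOn.comp (by fun_prop) fun y hy => ?_)
    exact hsub (hmem t ht y hy)
  have h0 : (0 : ℝ) ∈ ball (0 : ℝ) (δ / (B + 1)) := mem_ball_self (by positivity)
  have hnhds : ball (0 : ℝ) (δ / (B + 1)) ∈ nhds (0 : ℝ) := ball_mem_nhds _ (by positivity)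
  have hmain := hasDerivAt_integral_of_dominated_loc_of_deriv_le
    (μ := volume.restrict (closedBall (0 : Euc N) 1))
    (F := fun t y => (1 - ‖y‖ ^ 2) * F (a y + t • b y))
    (F' := fun t y => (1 - ‖y‖ ^ 2) * fderiv ℝ F (a y + t • b y) (b y)) (x₀ := (0 : ℝ))
    (bound := fun _ => M * B) hnhds
    (Filter.mem_of_superset hnhds fun t ht =>
      (hcont t ht).aestronglyMeasurable hK.measurableSet)
    ((hcont 0 h0).integrableOn_compact hK) ?_ ?_ ?_ ?_
  · simpa using hmain.2
  · refine ContinuousOn.aestronglyMeasurable ?_ hK.measurableSet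
    refine ContinuousOn.mul (by fun_prop) (ContinuousOn.clm_apply ?_ hb.continuousOn)
    refine hDF.comp (by fun_prop) fun y hy => hsub (hmem 0 h0 y hy)
  · refine (ae_restrict_iff' hK.measurableSet).2 (Filter.Eventually.of_forall fun y hy t ht => ?_)
    have hy1 : ‖y‖ ≤ 1 := by simpa using hy
    have h1 : ‖(1 - ‖y‖ ^ 2 : ℝ)‖ ≤ 1 := by
      rw [norm_eq_abs, abs_le]
      constructor <;> nlinarith [norm_nonneg y]
    rw [norm_mul]
    calc _ ≤ 1 * (M * B) := by
          refine mul_le_mul h1 ?_ (norm_nonneg _) zero_le_one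
          refine (ContinuousLinearMap.le_opNorm _ _).trans ?_
          exact mul_le_mul (hM _ (hmem t ht y hy)) (hB y hy) (norm_nonneg _) hM0
      _ = M * B := one_mul _
  · exact integrableOn_const hK.measure_lt_top.ne
  · refine (ae_restrict_iff' hK.measurableSet).2 (Filter.Eventually.of_forall fun y hy t ht => ?_)
    have hd : HasFDerivAt F (fderiv ℝ F (a y + t • b y)) (a y + t • b y) :=
      ((hF.differentiableOn one_ne_zero).differentiableAt
        (hΩ.mem_nhds (hsub (hmem t ht y hy)))).hasFDerivAt
    have hline : HasDerivAt (fun t : ℝ => a y + t • b y) (b y) t := by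
      simpa using ((hasDerivAt_id t).smul_const (b y)).const_add (a y)
    exact (hd.comp_hasDerivAt t hline).const_mul _

lemma HasMeanValue.fderiv_apply {F : Euc N → ℝ} (hΩ : IsOpen Ω) (hF : ContDiffOn ℝ 1 F Ω)
    (hmv : HasMeanValue Ω F) (e : Euc N) : HasMeanValue Ω (fun x => fderiv ℝ F x e) := by
  intro x s hs hsub
  have hintegrable := hasDerivAt_integral_translate hΩ hF (a := fun y => x + s • y) (b := fun _ => e)
    (by fun_prop) (by fun_prop) (fun y hy => hsub (by
      simpa [abs_of_nonneg hs] using add_smul_mem_closedBall (x := x) (s := s) hy))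
  have hx : x ∈ Ω := hsub (mem_closedBall_self hs)
  obtain ⟨δ, hδ, hthick⟩ := (isCompact_closedBall x s).exists_cthickening_subset_open hΩ hsub
  have hd : HasFDerivAt F (fderiv ℝ F x) (x + (0 : ℝ) • e) := by
    simpa using ((hF.differentiableOn one_ne_zero).differentiableAt
      (hΩ.mem_nhds hx)).hasFDerivAt
  have hline : HasDerivAt (fun t : ℝ => x + t • e) e 0 := by
    simpa using ((hasDerivAt_id (0 : ℝ)).smul_const e).const_add x
  have hright := (hd.comp_hasDerivAt (0 : ℝ) hline).const_mul
    (∫ y in closedBall (0 : Euc N) 1, (1 - ‖y‖ ^ 2))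
  refine hintegrable.unique (hright.congr_of_eventuallyEq ?_)
  have hball : ball (0 : ℝ) (δ / (‖e‖ + 1)) ∈ nhds (0 : ℝ) := ball_mem_nhds _ (by positivity)
  filter_upwards [hball] with t ht
  have h1 : ‖t‖ < δ / (‖e‖ + 1) := by simpa using ht
  have h2 : ‖t‖ * (‖e‖ + 1) < δ := (lt_div_iff₀ (by positivity)).1 h1
  have := hmv (x + t • e) s hs (fun z hz => hthick ?_)
  · simp only [Function.comp_apply]
    rw [← this]
    refine integral_congr_ae (Filter.Eventually.of_forall fun y => ?_)
    simp only [add_right_comm]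
  · refine mem_cthickening_of_dist_le _ (z - t • e) _ _ ?_ ?_
    · rw [mem_closedBall, dist_eq_norm] at hz ⊢
      convert hz using 2
      abel
    · rw [dist_eq_norm, sub_sub_cancel, norm_smul]
      nlinarith [norm_nonneg t]

lemma hasDerivAt_max_zero_sq (s : ℝ) :
    HasDerivAt (fun s : ℝ => (max s 0) ^ 2) (2 * max s 0) s := by
  rcases lt_trichotomy s 0 with hs | rfl | hs
  · rw [max_eq_right hs.le, mul_zero]
    refine (hasDerivAt_const s (0 : ℝ)).congr_of_eventuallyEq ?_
    filter_upwards [gt_mem_nhds hs] with t ht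
    simp [max_eq_right ht.le]
  · have : HasFDerivAt (fun s : ℝ => (max s 0) ^ 2) (0 : ℝ →L[ℝ] ℝ) 0 := by
      refine Asymptotics.IsBigO.hasFDerivAt (n := 2) ?_ one_lt_two
      refine Asymptotics.IsBigO.of_bound 1 (Filter.Eventually.of_forall fun t => ?_)
      rcases le_total t 0 with ht | ht <;> simp [ht, sq_nonneg]
    simpa using this.hasDerivAt
  · rw [max_eq_left hs.le]
    have : HasDerivAt (fun s : ℝ => s ^ 2) (2 * s) s := by simpa using hasDerivAt_pow 2 s
    refine this.congr_of_eventuallyEq ?_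
    filter_upwards [lt_mem_nhds hs] with t ht
    simp [max_eq_left ht.le]

/-- The squared bump `(1 - ‖y‖²)₊²`. -/
def bumpSq (y : Euc N) : ℝ := (max (1 - ‖y‖ ^ 2) 0) ^ 2

lemma hasFDerivAt_bumpSq (y : Euc N) :
    HasFDerivAt (bumpSq (N := N)) ((-4 * max (1 - ‖y‖ ^ 2) 0) • innerSL ℝ y) y := by
  have h1 : HasFDerivAt (fun y : Euc N => 1 - ‖y‖ ^ 2) (-(2 • innerSL ℝ y)) y :=
    ((hasStrictFDerivAt_norm_sq y).hasFDerivAt).const_sub 1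
  have h2 := (hasDerivAt_max_zero_sq (1 - ‖y‖ ^ 2)).comp_hasFDerivAt y h1
  refine h2.congr_fderiv ?_
  ext v
  simp
  ring

lemma bumpSq_eq_zero {y : Euc N} (hy : y ∉ closedBall (0 : Euc N) 1) : bumpSq y = 0 := by
  have : 1 < ‖y‖ := by simpa using hy
  rw [bumpSq, max_eq_right (by nlinarith)]
  norm_num

lemma tsupport_bumpSq_subset : tsupport (bumpSq (N := N)) ⊆ closedBall 0 1 :=
  closure_minimal (fun _ hy => by_contra fun h => hy (bumpSq_eq_zero h)) isClosed_closedBall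

lemma inner_single_eq (y : Euc N) (i : Fin N) :
    ⟪y, EuclideanSpace.single i (1 : ℝ)⟫ = y i := by
  simp [EuclideanSpace.inner_single_right]

lemma clm_apply_eq_sum (L : Euc N →L[ℝ] ℝ) (y : Euc N) :
    L y = ∑ i, y i * L (EuclideanSpace.single i (1 : ℝ)) := by
  conv_lhs => rw [← (EuclideanSpace.basisFun (Fin N) ℝ).sum_repr y]
  simp

lemma contDiffOn_fderiv_apply {F : Euc N → ℝ} (hΩ : IsOpen Ω) (hF : ContDiffOn ℝ 2 F Ω)
    (e : Euc N) : ContDiffOn ℝ 1 (fun x => fderiv ℝ F x e) Ω :=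
  (hF.fderiv_of_isOpen hΩ (m := 1) (by norm_num)).clm_apply contDiffOn_const

lemma integral_fderiv_radial_eq_zero {h : Euc N → ℝ} (hΩ : IsOpen Ω) (hh : ContDiffOn ℝ 2 h Ω)
    (hlap : ∀ x ∈ Ω, lap h x = 0) {x : Euc N} {ρ : ℝ} (hsub : closedBall x |ρ| ⊆ Ω) :
    ∫ y in closedBall (0 : Euc N) 1, (1 - ‖y‖ ^ 2) * fderiv ℝ h (x + ρ • y) y = 0 := by
  have hK : IsCompact (closedBall (0 : Euc N) 1) := isCompact_closedBall _ _
  have hmem : ∀ y ∈ closedBall (0 : Euc N) 1, x + ρ • y ∈ Ω := fun y hy =>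
    hsub (add_smul_mem_closedBall hy)
  set f : Fin N → Euc N → ℝ := fun i y =>
    fderiv ℝ h (x + ρ • y) (EuclideanSpace.single i (1 : ℝ)) with hf
  have hC1 := fun i : Fin N => contDiffOn_fderiv_apply hΩ hh (EuclideanSpace.single i (1 : ℝ))
  have hfd : ∀ i, ∀ y ∈ closedBall (0 : Euc N) 1,
      HasFDerivAt (f i) (ρ • fderiv ℝ (fun z => fderiv ℝ h z (EuclideanSpace.single i (1 : ℝ)))
        (x + ρ • y)) y := by
    intro i y hy
    have h1 := (((hC1 i).differentiableOn one_ne_zero).differentiableAt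
      (hΩ.mem_nhds (hmem y hy))).hasFDerivAt
    have h2 : HasFDerivAt (fun y : Euc N => x + ρ • y) (ρ • ContinuousLinearMap.id ℝ (Euc N)) y :=
      ((hasFDerivAt_id y).const_smul ρ).const_add x
    refine (h1.comp y h2).congr_fderiv ?_
    ext v
    simp
  have hcf : ∀ i, ContinuousOn (f i) (closedBall 0 1) := fun i y hy =>
    (hfd i y hy).continuousAt.continuousWithinAt
  have hcb : Continuous (bumpSq (N := N)) := by
    unfold bumpSq
    fun_prop
  have hch : ∀ i, ContinuousOn (fun y => hessEntry h (x + ρ • y) i i) (closedBall 0 1) := by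
    intro i
    have := ((hC1 i).continuousOn_fderiv_of_isOpen hΩ le_rfl).clm_apply
      (continuousOn_const (c := EuclideanSpace.single i (1 : ℝ)))
    exact this.comp (f := fun y => x + ρ • y) (by fun_prop) hmem
  have hintegrable : ∀ {g : Euc N → ℝ}, ContinuousOn g (closedBall 0 1) →
      (∀ y ∉ closedBall (0 : Euc N) 1, g y = 0) → Integrable g := fun hg h0 =>
    (hg.integrableOn_compact hK).integrable_of_forall_notMem_eq_zero h0
  have hdb : ∀ (i : Fin N) (y : Euc N), fderiv ℝ bumpSq y (EuclideanSpace.single i (1 : ℝ)) =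
      -4 * max (1 - ‖y‖ ^ 2) 0 * y i := by
    intro i y
    rw [(hasFDerivAt_bumpSq y).fderiv]
    simp only [smul_apply, innerSL_apply_apply, inner_single_eq, smul_eq_mul]
  have hmax0 : ∀ y ∉ closedBall (0 : Euc N) 1, max (1 - ‖y‖ ^ 2) 0 = 0 := by
    intro y hy
    have : 1 < ‖y‖ := by simpa using hy
    exact max_eq_right (by nlinarith)
  have hmul : ∀ i, ∀ y, fderiv ℝ (f i) y (EuclideanSpace.single i (1 : ℝ)) * bumpSq y =
      ρ * (hessEntry h (x + ρ • y) i i * bumpSq y) := by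
    intro i y
    by_cases hy : y ∈ closedBall (0 : Euc N) 1
    · rw [(hfd i y hy).fderiv]
      simp [hessEntry, mul_assoc]
    · simp [bumpSq_eq_zero hy]
  have hi1 : ∀ i, Integrable (fun y => hessEntry h (x + ρ • y) i i * bumpSq y) := fun i =>
    hintegrable ((hch i).mul hcb.continuousOn) fun y hy => by simp [bumpSq_eq_zero hy]
  have hi2 : ∀ i, Integrable
      (fun y => f i y * fderiv ℝ bumpSq y (EuclideanSpace.single i (1 : ℝ))) := by
    intro i
    simp only [hdb]
    exact hintegrable ((hcf i).mul (by fun_prop)) fun y hy => by simp [hmax0 y hy]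
  have hibp : ∀ i, ∫ y, f i y * fderiv ℝ bumpSq y (EuclideanSpace.single i (1 : ℝ)) =
      -∫ y, ρ * (hessEntry h (x + ρ • y) i i * bumpSq y) := by
    intro i
    rw [integral_mul_fderiv_eq_neg_fderiv_mul_of_integrable]
    · simp only [hmul]
    · simp only [hmul]
      exact (hi1 i).const_mul ρ
    · exact hi2 i
    · exact hintegrable ((hcf i).mul hcb.continuousOn) fun y hy => by simp [bumpSq_eq_zero hy]
    · exact fun y hy => (hfd i y (tsupport_bumpSq_subset hy)).differentiableAt
    · exact fun y _ => (hasFDerivAt_bumpSq y).differentiableAt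
  have hsum : ∫ y, ∑ i, f i y * fderiv ℝ bumpSq y (EuclideanSpace.single i (1 : ℝ)) = 0 := by
    rw [integral_finsetSum _ fun i _ => hi2 i, Finset.sum_congr rfl fun i _ => hibp i,
      Finset.sum_neg_distrib, ← integral_finsetSum _ fun i _ => (hi1 i).const_mul ρ, neg_eq_zero]
    refine integral_eq_zero_of_ae (Filter.Eventually.of_forall fun y => ?_)
    by_cases hy : y ∈ closedBall (0 : Euc N) 1
    · have := hlap _ (hmem y hy)
      simp only [← Finset.mul_sum, ← Finset.sum_mul]
      rw [lap] at this
      simp [this]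
    · simp [bumpSq_eq_zero hy]
  rw [← setIntegral_eq_integral_of_forall_compl_eq_zero (s := closedBall (0 : Euc N) 1)] at hsum
  · have heq : ∫ y in closedBall (0 : Euc N) 1,
        ∑ i, f i y * fderiv ℝ bumpSq y (EuclideanSpace.single i (1 : ℝ)) =
        ∫ y in closedBall (0 : Euc N) 1, -4 * ((1 - ‖y‖ ^ 2) * fderiv ℝ h (x + ρ • y) y) := by
      refine setIntegral_congr_fun hK.measurableSet fun y hy => ?_
      have hy1 : ‖y‖ ≤ 1 := by simpa using hy
      simp only [hdb]
      rw [max_eq_left (by nlinarith [norm_nonneg y]), clm_apply_eq_sum (fderiv ℝ h (x + ρ • y)) y,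
        Finset.mul_sum, Finset.mul_sum]
      refine Finset.sum_congr rfl fun i _ => ?_
      simp only [hf]
      ring
    rw [heq, integral_const_mul] at hsum
    linarith
  · intro y hy
    simp [hdb, hmax0 y hy]

lemma hasMeanValue_of_lap_eq_zero {h : Euc N → ℝ} (hΩ : IsOpen Ω) (hh : ContDiffOn ℝ 2 h Ω)
    (hlap : ∀ x ∈ Ω, lap h x = 0) : HasMeanValue Ω h := by
  intro x s hs hsub
  set I : ℝ → ℝ := fun ρ => ∫ y in closedBall (0 : Euc N) 1, (1 - ‖y‖ ^ 2) * h (x + ρ • y)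
  have hderiv : ∀ ρ ∈ Icc (0 : ℝ) s, HasDerivAt I 0 ρ := by
    intro ρ hρ
    have hsubρ : closedBall x |ρ| ⊆ Ω := (closedBall_subset_closedBall
      (by rw [abs_of_nonneg hρ.1]; exact hρ.2)).trans hsub
    have h1 := hasDerivAt_integral_translate hΩ (hh.of_le one_le_two)
      (a := fun y => x + ρ • y) (b := fun y => y) (by fun_prop) (by fun_prop)
      (fun y hy => hsubρ (add_smul_mem_closedBall hy))
    rw [integral_fderiv_radial_eq_zero hΩ hh hlap hsubρ] at h1
    have h2 : HasDerivAt (fun t => I (ρ + t)) 0 0 := by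
      convert h1 using 2 with t
      simp only [I, add_smul, add_assoc]
    have h3 : HasDerivAt (fun t => I (ρ + t)) 0 (ρ - ρ) := by simpa using h2
    simpa using h3.comp_sub_const ρ ρ
  have := constant_of_has_deriv_right_zero
    (fun ρ hρ => (hderiv ρ hρ).continuousAt.continuousWithinAt)
    (fun ρ hρ => (hderiv ρ ⟨hρ.1, hρ.2.le⟩).hasDerivWithinAt) s ⟨hs, le_rfl⟩
  simpa [I, integral_mul_const] using this

end MeanValue

section HessianBound

variable {N : ℕ} {Ω : Set (Euc N)}

lemma continuousOn_hessEntry {h : Euc N → ℝ} (hΩ : IsOpen Ω) (hh : ContDiffOn ℝ 2 h Ω)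
    (i j : Fin N) : ContinuousOn (fun x => hessEntry h x i j) Ω :=
  ((contDiffOn_fderiv_apply hΩ hh _).continuousOn_fderiv_of_isOpen hΩ le_rfl).clm_apply
    continuousOn_const

lemma continuousOn_sqrt_hessNormSq {h : Euc N → ℝ} (hΩ : IsOpen Ω) (hh : ContDiffOn ℝ 2 h Ω) :
    ContinuousOn (fun x => √(hessNormSq h x)) Ω := by
  refine ContinuousOn.sqrt ?_
  unfold hessNormSq
  exact continuousOn_finsetSum _ fun i _ => continuousOn_finsetSum _ fun j _ =>
    (continuousOn_hessEntry hΩ hh i j).pow 2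

lemma abs_hessEntry_le (h : Euc N → ℝ) (x : Euc N) (i j : Fin N) :
    |hessEntry h x i j| ≤ √(hessNormSq h x) := by
  refine abs_le_sqrt ?_
  refine (Finset.single_le_sum (f := fun j => hessEntry h x i j ^ 2)
    (fun _ _ => sq_nonneg _) (Finset.mem_univ j)).trans ?_
  exact Finset.single_le_sum (f := fun i => ∑ j, hessEntry h x i j ^ 2)
    (fun _ _ => Finset.sum_nonneg fun _ _ => sq_nonneg _) (Finset.mem_univ i)

lemma sqrt_hessNormSq_le_of_forall {h : Euc N → ℝ} {x : Euc N} {B : ℝ} (hB : 0 ≤ B)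
    (hle : ∀ i j, |hessEntry h x i j| ≤ B) : √(hessNormSq h x) ≤ N * B := by
  refine sqrt_le_iff.2 ⟨by positivity, ?_⟩
  calc hessNormSq h x ≤ ∑ _i : Fin N, ∑ _j : Fin N, B ^ 2 :=
        Finset.sum_le_sum fun i _ => Finset.sum_le_sum fun j _ => sq_le_sq' (abs_le.1 (hle i j)).1
          (abs_le.1 (hle i j)).2
    _ = (N * B) ^ 2 := by simp; ring

lemma lintegral_rpow_le_mul {α : Type*} [MeasurableSpace α] {μ : Measure α} {p : ℝ} (hp : 1 ≤ p)
    {f : α → ENNReal} (hf : AEMeasurable f μ) :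
    (∫⁻ x, f x ∂μ) ^ p ≤ μ univ ^ (p - 1) * ∫⁻ x, f x ^ p ∂μ := by
  have hp0 : 0 < p := by linarith
  have := eLpNorm'_le_eLpNorm'_mul_rpow_measure_univ (μ := μ) (f := f) zero_lt_one hp
    hf.aestronglyMeasurable
  simp only [eLpNorm'_eq_lintegral_enorm, enorm_eq_self, ENNReal.rpow_one, div_one] at this
  refine (ENNReal.rpow_le_rpow this hp0.le).trans ?_
  rw [ENNReal.mul_rpow_of_nonneg _ _ hp0.le, ← ENNReal.rpow_mul, ← ENNReal.rpow_mul, mul_comm,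
    one_div_mul_cancel hp0.ne', ENNReal.rpow_one]
  refine le_of_eq ?_
  congr 2
  field_simp

lemma lintegral_closedBall_rescale {G : Euc N → ENNReal} (hG : Measurable G) (x : Euc N) {s : ℝ}
    (hs : 0 < s) :
    ∫⁻ y in closedBall (0 : Euc N) 1, G (x + s • y) =
      ENNReal.ofReal (s ^ N)⁻¹ * ∫⁻ z in closedBall x s, G z := by
  have hG' : Measurable ((closedBall x s).indicator G) := hG.indicator measurableSet_closedBall
  rw [← lintegral_indicator measurableSet_closedBall,
    ← lintegral_indicator measurableSet_closedBall,
    ← lintegral_add_left_eq_self ((closedBall x s).indicator G) x]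
  have h1 := lintegral_map (μ := (volume : Measure (Euc N))) (g := fun y : Euc N => s • y)
    (f := fun z => (closedBall x s).indicator G (x + z)) (by fun_prop) (by fun_prop)
  rw [Measure.map_addHaar_smul _ hs.ne', lintegral_smul_measure] at h1
  simp only [finrank_euclideanSpace, Fintype.card_fin, abs_of_pos (inv_pos.2 (pow_pos hs N)),
    smul_eq_mul] at h1
  rw [h1]
  refine lintegral_congr fun y => ?_
  have : y ∈ closedBall (0 : Euc N) 1 ↔ x + s • y ∈ closedBall x s := by
    simp [norm_smul, abs_of_pos hs, mul_le_iff_le_one_right hs]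
  by_cases hy : y ∈ closedBall (0 : Euc N) 1
  · rw [indicator_of_mem hy, indicator_of_mem (this.1 hy)]
  · rw [indicator_of_notMem hy, indicator_of_notMem (mt this.2 hy)]

lemma integral_weight_pos :
    0 < ∫ y in closedBall (0 : Euc N) 1, (1 - ‖y‖ ^ 2) := by
  have hK : IsCompact (closedBall (0 : Euc N) 1) := isCompact_closedBall _ _
  rw [setIntegral_pos_iff_support_of_nonneg_ae]
  · refine (measure_ball_pos volume (0 : Euc N) one_pos).trans_le (measure_mono fun y hy => ?_)
    refine ⟨?_, ball_subset_closedBall hy⟩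
    have : ‖y‖ < 1 := by simpa using hy
    rw [Function.mem_support]
    nlinarith [norm_nonneg y]
  · refine (ae_restrict_iff' hK.measurableSet).2 (Filter.Eventually.of_forall fun y hy => ?_)
    have : ‖y‖ ≤ 1 := by simpa using hy
    simp only [Pi.zero_apply]
    nlinarith [norm_nonneg y]
  · exact ContinuousOn.integrableOn_compact hK (by fun_prop)

lemma measurable_indicator_ofReal {f : Euc N → ℝ} (hΩ : IsOpen Ω) (hf : ContinuousOn f Ω) :
    Measurable (Ω.indicator fun x => ENNReal.ofReal (f x)) := by
  classical
  rw [← piecewise_eq_indicator]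
  exact (ENNReal.continuous_ofReal.comp_continuousOn hf).measurable_piecewise continuousOn_const
    hΩ.measurableSet

lemma exists_hessian_mean_bound (N : ℕ) {p : ℝ} (hp : 1 ≤ p) :
    ∃ C > (0 : ℝ), ∀ (Ω : Set (Euc N)) (h : Euc N → ℝ), IsOpen Ω → ContDiffOn ℝ 2 h Ω →
      (∀ x ∈ Ω, lap h x = 0) → ∀ (x : Euc N) (s : ℝ), 0 < s → closedBall x s ⊆ Ω →
      ENNReal.ofReal (√(hessNormSq h x) ^ p) ≤
        ENNReal.ofReal (C * (s ^ N)⁻¹) *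
          ∫⁻ y in closedBall x s, ENNReal.ofReal (√(hessNormSq h y) ^ p) := by
  have hp0 : 0 < p := by linarith
  have hK : IsCompact (closedBall (0 : Euc N) 1) := isCompact_closedBall _ _
  set κ := ∫ y in closedBall (0 : Euc N) 1, (1 - ‖y‖ ^ 2) with hκ
  have hκ0 : 0 < κ := integral_weight_pos
  set V := volume.real (closedBall (0 : Euc N) 1)
  have hV : 0 ≤ V := measureReal_nonneg
  refine ⟨(N * κ⁻¹) ^ p * V ^ (p - 1) + 1, by positivity, fun Ω h hΩ hh hlap x s hs hsub => ?_⟩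
  have hmem : ∀ y ∈ closedBall (0 : Euc N) 1, x + s • y ∈ Ω := fun y hy =>
    hsub (by simpa [abs_of_pos hs] using add_smul_mem_closedBall (x := x) (s := s) hy)
  have hH := continuousOn_sqrt_hessNormSq hΩ hh
  have hHs : ContinuousOn (fun y => √(hessNormSq h (x + s • y))) (closedBall 0 1) :=
    hH.comp (f := fun y => x + s • y) (by fun_prop) hmem
  set J := ∫ y in closedBall (0 : Euc N) 1, √(hessNormSq h (x + s • y)) with hJ
  have hJ0 : 0 ≤ J := integral_nonneg fun _ => sqrt_nonneg _
  have hentry : ∀ i j, |hessEntry h x i j| ≤ κ⁻¹ * J := by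
    intro i j
    have hmv := ((hasMeanValue_of_lap_eq_zero hΩ hh hlap).fderiv_apply hΩ (hh.of_le one_le_two)
      (EuclideanSpace.single j (1 : ℝ))).fderiv_apply hΩ (contDiffOn_fderiv_apply hΩ hh _)
      (EuclideanSpace.single i (1 : ℝ)) x s hs.le hsub
    change ∫ y in closedBall (0 : Euc N) 1, (1 - ‖y‖ ^ 2) * hessEntry h (x + s • y) i j =
      κ * hessEntry h x i j at hmv
    have h1 : κ * |hessEntry h x i j| ≤ J := by
      rw [← abs_of_pos hκ0, ← abs_mul, ← hmv, ← norm_eq_abs]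
      refine norm_integral_le_of_norm_le (hHs.integrableOn_compact hK) ?_
      refine (ae_restrict_iff' hK.measurableSet).2 (Filter.Eventually.of_forall fun y hy => ?_)
      have hy1 : ‖y‖ ≤ 1 := by simpa using hy
      rw [norm_mul, norm_eq_abs, norm_eq_abs]
      refine (mul_le_of_le_one_left (abs_nonneg _) ?_).trans (abs_hessEntry_le _ _ _ _)
      rw [abs_le]
      constructor <;> nlinarith [norm_nonneg y]
    rw [inv_mul_eq_div, le_div_iff₀ hκ0, mul_comm]
    exact h1
  have hle := sqrt_hessNormSq_le_of_forall (by positivity) hentry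
  set G : Euc N → ENNReal := Ω.indicator fun x => ENNReal.ofReal (√(hessNormSq h x) ^ p) with hG
  have hGm : Measurable G :=
    measurable_indicator_ofReal hΩ (hH.rpow_const fun _ _ => Or.inr hp0.le)
  have hJp : ENNReal.ofReal J ^ p ≤ ENNReal.ofReal (V ^ (p - 1)) *
      (ENNReal.ofReal (s ^ N)⁻¹ * ∫⁻ z in closedBall x s, G z) := by
    rw [hJ, ofReal_integral_eq_lintegral_ofReal (hHs.integrableOn_compact hK)
      (Filter.Eventually.of_forall fun _ => sqrt_nonneg _), ← lintegral_closedBall_rescale hGm x hs]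
    refine (lintegral_rpow_le_mul hp
      (hHs.aemeasurable hK.measurableSet).ennreal_ofReal).trans (le_of_eq ?_)
    rw [Measure.restrict_apply_univ, ← ENNReal.ofReal_rpow_of_nonneg hV (by linarith),
      ofReal_measureReal hK.measure_lt_top.ne]
    congr 1
    refine setLIntegral_congr_fun hK.measurableSet fun y hy => ?_
    simp only [hG]
    rw [indicator_of_mem (hmem y hy), ENNReal.ofReal_rpow_of_nonneg (sqrt_nonneg _) hp0.le]
  have hGint : ∫⁻ z in closedBall x s, G z =
      ∫⁻ y in closedBall x s, ENNReal.ofReal (√(hessNormSq h y) ^ p) :=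
    setLIntegral_congr_fun measurableSet_closedBall fun y hy => indicator_of_mem (hsub hy) _
  rw [← hGint]
  calc ENNReal.ofReal (√(hessNormSq h x) ^ p)
      ≤ ENNReal.ofReal ((N * κ⁻¹) ^ p) * ENNReal.ofReal J ^ p := by
        rw [ENNReal.ofReal_rpow_of_nonneg hJ0 hp0.le, ← ENNReal.ofReal_mul (by positivity),
          ← mul_rpow (by positivity) hJ0]
        refine ENNReal.ofReal_le_ofReal (rpow_le_rpow (sqrt_nonneg _) ?_ hp0.le)
        rwa [mul_assoc]
    _ ≤ ENNReal.ofReal ((N * κ⁻¹) ^ p) * (ENNReal.ofReal (V ^ (p - 1)) *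
        (ENNReal.ofReal (s ^ N)⁻¹ * ∫⁻ z in closedBall x s, G z)) := by gcongr
    _ = ENNReal.ofReal ((N * κ⁻¹) ^ p * V ^ (p - 1) * (s ^ N)⁻¹) * ∫⁻ z in closedBall x s, G z := by
        rw [← mul_assoc, ← mul_assoc, ← ENNReal.ofReal_mul (by positivity),
          ← ENNReal.ofReal_mul (by positivity)]
    _ ≤ _ := by
        gcongr
        linarith

end HessianBound

section WeightedBounds

variable {N : ℕ} {Ω : Set (Euc N)}

/-- The weighted integrand `dist(x, ∂Ω) ^ (αp) |∇²h| ^ p`. -/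
def weightedHess (Ω : Set (Euc N)) (h : Euc N → ℝ) (p α : ℝ) (x : Euc N) : ENNReal :=
  ENNReal.ofReal (infDist x (frontier Ω) ^ (α * p) * √(hessNormSq h x) ^ p)

lemma closedBall_half_infDist_subset (hΩ : IsOpen Ω) (hf : (frontier Ω).Nonempty) {x : Euc N}
    (hx : x ∈ Ω) : closedBall x (infDist x (frontier Ω) / 2) ⊆ Ω :=
  (closedBall_subset_ball (half_lt_self (infDist_frontier_pos hΩ hf hx))).trans
    (ball_infDist_frontier_subset hΩ hx)

lemma exists_hessian_weighted_bound (N : ℕ) {p α : ℝ} (hp : 1 ≤ p) (hα : 0 ≤ α) :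
    ∃ C > (0 : ℝ), ∀ (Ω : Set (Euc N)) (h : Euc N → ℝ), IsOpen Ω → (frontier Ω).Nonempty →
      ContDiffOn ℝ 2 h Ω → (∀ x ∈ Ω, lap h x = 0) → ∀ x ∈ Ω,
      ENNReal.ofReal (√(hessNormSq h x) ^ p) ≤
        ENNReal.ofReal (C * infDist x (frontier Ω) ^ (-(N + α * p))) *
          ∫⁻ y in closedBall x (infDist x (frontier Ω) / 2), weightedHess Ω h p α y := by
  obtain ⟨C, hC, hbound⟩ := exists_hessian_mean_bound N hp
  have hαp : 0 ≤ α * p := by positivity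
  refine ⟨C * 2 ^ (N + α * p), by positivity, fun Ω h hΩ hf hh hlap x hx => ?_⟩
  have hδ := infDist_frontier_pos hΩ hf hx
  have hsub := closedBall_half_infDist_subset hΩ hf hx
  set δ := infDist x (frontier Ω) with hδdef
  refine (hbound Ω h hΩ hh hlap x (δ / 2) (half_pos hδ) hsub).trans ?_
  have hmono : ∫⁻ y in closedBall x (δ / 2), ENNReal.ofReal (√(hessNormSq h y) ^ p) ≤
      ENNReal.ofReal ((δ / 2) ^ (-(α * p))) *
        ∫⁻ y in closedBall x (δ / 2), weightedHess Ω h p α y := by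
    rw [← lintegral_const_mul' _ _ ENNReal.ofReal_ne_top]
    refine setLIntegral_mono' measurableSet_closedBall fun y hy => ?_
    rw [weightedHess, ← ENNReal.ofReal_mul (by positivity)]
    refine ENNReal.ofReal_le_ofReal ?_
    have hδy : δ / 2 ≤ infDist y (frontier Ω) := by
      have h1 := infDist_le_infDist_add_dist (x := x) (y := y) (s := frontier Ω)
      have h2 : dist x y ≤ δ / 2 := by rw [dist_comm]; exact hy
      linarith
    have h3 : (δ / 2) ^ (α * p) ≤ infDist y (frontier Ω) ^ (α * p) :=
      rpow_le_rpow (by positivity) hδy hαp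
    rw [rpow_neg (by positivity), ← mul_assoc]
    refine le_mul_of_one_le_left (by positivity) ?_
    rw [inv_mul_eq_div, one_le_div (by positivity)]
    exact h3
  calc _ ≤ ENNReal.ofReal (C * ((δ / 2) ^ N)⁻¹) * (ENNReal.ofReal ((δ / 2) ^ (-(α * p))) *
        ∫⁻ y in closedBall x (δ / 2), weightedHess Ω h p α y) := by gcongr
    _ = _ := by
      rw [← mul_assoc, ← ENNReal.ofReal_mul (by positivity)]
      congr 2
      rw [div_rpow hδ.le (by norm_num), ← rpow_natCast, div_rpow hδ.le (by norm_num), neg_add,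
        rpow_add hδ, rpow_add two_pos, rpow_neg hδ.le, rpow_neg hδ.le, rpow_neg (by norm_num)]
      field_simp

lemma measurable_indicator_weightedHess {h : Euc N → ℝ} {p α : ℝ} (hΩ : IsOpen Ω)
    (hh : ContDiffOn ℝ 2 h Ω) (hp : 0 ≤ p) (hα : 0 ≤ α) :
    Measurable (Ω.indicator (weightedHess Ω h p α)) :=
  measurable_indicator_ofReal hΩ (((continuous_infDist_pt _).continuousOn.rpow_const
    fun _ _ => Or.inr (by positivity)).mul ((continuousOn_sqrt_hessNormSq hΩ hh).rpow_const
    fun _ _ => Or.inr hp))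

/-- Averaging over the balls of radius half the distance to the boundary is bounded on `L¹`. -/
lemma lintegral_whitney_average_le (hΩ : IsOpen Ω) (hf : (frontier Ω).Nonempty)
    {G : Euc N → ENNReal} (hG : Measurable (Ω.indicator G)) :
    ∫⁻ x in Ω, ENNReal.ofReal ((infDist x (frontier Ω) ^ N)⁻¹) *
        ∫⁻ y in closedBall x (infDist x (frontier Ω) / 2), G y ≤
      ENNReal.ofReal ((3 / 2) ^ N * volume.real (ball (0 : Euc N) 1)) * ∫⁻ y in Ω, G y := by
  set δ : Euc N → ℝ := fun x => infDist x (frontier Ω) with hδ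
  have hδc : Continuous δ := continuous_infDist_pt _
  set S : Set (Euc N × Euc N) := {q | dist q.2 q.1 ≤ δ q.1 / 2} with hS
  have hSm : MeasurableSet S := (isClosed_le (by fun_prop) (by fun_prop)).measurableSet
  set Φ : Euc N → Euc N → ENNReal := fun x y =>
    S.indicator (fun q => ENNReal.ofReal ((δ q.1 ^ N)⁻¹) * Ω.indicator G q.2) (x, y) with hΦ
  have hΦm : Measurable (Function.uncurry Φ) := by
    refine Measurable.indicator ?_ hSm
    exact ((hδc.measurable.comp measurable_fst).pow_const N).inv.ennreal_ofReal.mul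
      (hG.comp measurable_snd)
  have hleft : ∫⁻ x in Ω, ENNReal.ofReal ((δ x ^ N)⁻¹) * ∫⁻ y in closedBall x (δ x / 2), G y =
      ∫⁻ x in Ω, ∫⁻ y, Φ x y := by
    refine setLIntegral_congr_fun hΩ.measurableSet fun x hx => ?_
    rw [← lintegral_const_mul' _ _ ENNReal.ofReal_ne_top,
      ← lintegral_indicator measurableSet_closedBall]
    refine lintegral_congr fun y => ?_
    by_cases hy : y ∈ closedBall x (δ x / 2)
    · have hyΩ := closedBall_half_infDist_subset hΩ hf hx hy
      have : (x, y) ∈ S := hy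
      rw [indicator_of_mem hy, hΦ]
      simp only [indicator_of_mem this, indicator_of_mem hyΩ]
    · have : (x, y) ∉ S := hy
      rw [indicator_of_notMem hy, hΦ]
      simp only [indicator_of_notMem this]
  have hright : ∀ y, ∫⁻ x in Ω, Φ x y ≤
      ENNReal.ofReal ((3 / 2) ^ N * volume.real (ball (0 : Euc N) 1)) * Ω.indicator G y := by
    intro y
    by_cases hy : y ∈ Ω
    · have hδy : 0 < δ y := infDist_frontier_pos hΩ hf hy
      have hle : ∀ x ∈ Ω, Φ x y ≤ (closedBall y (δ y)).indicator
          (fun _ => ENNReal.ofReal ((3 / 2) ^ N * (δ y ^ N)⁻¹) * Ω.indicator G y) x := by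
        intro x hx
        by_cases hxy : (x, y) ∈ S
        · have h1 : dist y x ≤ δ x / 2 := hxy
          have h2 : δ y ≤ δ x + dist y x := infDist_le_infDist_add_dist
          have h3 : δ x ≤ δ y + dist x y := infDist_le_infDist_add_dist
          have h4 : x ∈ closedBall y (δ y) := by
            rw [mem_closedBall]
            linarith [dist_comm x y]
          rw [indicator_of_mem h4, hΦ]
          simp only [indicator_of_mem hxy]
          gcongr
          have hδx : 0 < δ x := infDist_frontier_pos hΩ hf hx
          rw [← div_eq_mul_inv, le_div_iff₀ (by positivity), inv_mul_eq_div, ← div_pow]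
          refine pow_le_pow_left₀ (by positivity) ?_ N
          rw [div_le_iff₀ hδx]
          linarith
        · rw [hΦ]
          simp only [indicator_of_notMem hxy]
          exact zero_le
      refine (setLIntegral_mono' hΩ.measurableSet hle).trans ?_
      refine (setLIntegral_le_lintegral _ _).trans ?_
      rw [lintegral_indicator_const measurableSet_closedBall, Measure.addHaar_closedBall _ _ hδy.le,
        finrank_euclideanSpace, Fintype.card_fin, mul_right_comm]
      refine mul_le_mul_left (le_of_eq ?_) _
      rw [← ofReal_measureReal measure_ball_lt_top.ne, ← ENNReal.ofReal_mul (by positivity),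
        ← ENNReal.ofReal_mul (by positivity)]
      congr 1
      field_simp
    · have h0 : ∀ x, Φ x y = 0 := fun x => by
        simp only [hΦ, indicator_apply S, indicator_of_notMem hy, mul_zero, ite_self]
      simp [h0]
  rw [hleft, lintegral_lintegral_swap hΦm.aemeasurable]
  refine (lintegral_mono hright).trans ?_
  rw [lintegral_const_mul _ hG, lintegral_indicator hΩ.measurableSet]

lemma exists_lintegral_dist_mul_hessian_le (N : ℕ) {p r α d : ℝ} (hp : 1 ≤ p) (hpr : p ≤ r)
    (hα : 0 ≤ α) (hd : 0 < d) (hexp : r * (N - p * (1 - α)) ≤ N * p) :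
    ∃ C > (0 : ℝ), ∀ (Ω : Set (Euc N)) (h : Euc N → ℝ), IsOpen Ω → (frontier Ω).Nonempty →
      Bornology.IsBounded Ω → diam Ω ≤ d →
      ContDiffOn ℝ 2 h Ω → (∀ x ∈ Ω, lap h x = 0) →
      ∫⁻ x in Ω, ENNReal.ofReal ((infDist x (frontier Ω) * √(hessNormSq h x)) ^ r) ≤
        ENNReal.ofReal C * (∫⁻ x in Ω, weightedHess Ω h p α x) ^ (r / p) := by
  obtain ⟨C, hC, hbound⟩ := exists_hessian_weighted_bound N hp hα
  have hp0 : 0 < p := by linarith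
  have hr0 : 0 < r := by linarith
  set e := r - (N + α * p) * (r / p) + N with he
  have he0 : 0 ≤ e := by
    have : e = (N * p - r * (N - p * (1 - α))) / p := by rw [he]; field_simp; ring
    rw [this]
    exact div_nonneg (by linarith) hp0.le
  set V := volume.real (ball (0 : Euc N) 1)
  have hV : 0 ≤ V := measureReal_nonneg
  refine ⟨C ^ (r / p) * d ^ e * ((3 / 2) ^ N * V) + 1, by positivity,
    fun Ω h hΩ hf hb hdiam hh hlap => ?_⟩
  set A := ∫⁻ x in Ω, weightedHess Ω h p α x with hA
  have hpt : ∀ x ∈ Ω, ENNReal.ofReal ((infDist x (frontier Ω) * √(hessNormSq h x)) ^ r) ≤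
      ENNReal.ofReal (C ^ (r / p) * d ^ e) * A ^ (r / p - 1) *
        (ENNReal.ofReal ((infDist x (frontier Ω) ^ N)⁻¹) *
          ∫⁻ y in closedBall x (infDist x (frontier Ω) / 2), weightedHess Ω h p α y) := by
    intro x hx
    have hδ := infDist_frontier_pos hΩ hf hx
    have hδd : infDist x (frontier Ω) ≤ d := (infDist_frontier_le_diam hf hb hx).trans hdiam
    have hloc := hbound Ω h hΩ hf hh hlap x hx
    have hsub := closedBall_half_infDist_subset hΩ hf hx
    set δ := infDist x (frontier Ω)
    set I := ∫⁻ y in closedBall x (δ / 2), weightedHess Ω h p α y with hI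
    have hIA : I ≤ A := lintegral_mono_set hsub
    have hrp : 0 ≤ r / p := by positivity
    have hrp1 : 0 ≤ r / p - 1 := by
      rw [sub_nonneg, one_le_div hp0]
      exact hpr
    have hIr : I ^ (r / p) ≤ A ^ (r / p - 1) * I := by
      calc I ^ (r / p) = I ^ (r / p - 1) * I ^ (1 : ℝ) := by
            rw [← ENNReal.rpow_add_of_nonneg _ _ hrp1 zero_le_one, sub_add_cancel]
        _ ≤ _ := by
            rw [ENNReal.rpow_one]
            gcongr
    have hreal : δ ^ r * (C * δ ^ (-(N + α * p))) ^ (r / p) ≤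
        C ^ (r / p) * d ^ e * (δ ^ N)⁻¹ := by
      have h1 : δ ^ r * (C * δ ^ (-(N + α * p))) ^ (r / p) =
          C ^ (r / p) * δ ^ e * (δ ^ N)⁻¹ := by
        rw [mul_rpow hC.le (by positivity), ← rpow_mul hδ.le, mul_left_comm, ← rpow_add hδ,
          ← rpow_natCast, ← rpow_neg hδ.le, mul_assoc, ← rpow_add hδ]
        congr 2
        rw [he]
        ring
      rw [h1]
      gcongr
    calc ENNReal.ofReal ((δ * √(hessNormSq h x)) ^ r)
        = ENNReal.ofReal (δ ^ r) * ENNReal.ofReal (√(hessNormSq h x) ^ p) ^ (r / p) := by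
          rw [ENNReal.ofReal_rpow_of_nonneg (by positivity) hrp, ← rpow_mul (sqrt_nonneg _),
            mul_div_cancel₀ _ hp0.ne', ← ENNReal.ofReal_mul (by positivity),
            mul_rpow hδ.le (sqrt_nonneg _)]
      _ ≤ ENNReal.ofReal (δ ^ r) * (ENNReal.ofReal (C * δ ^ (-(N + α * p))) * I) ^ (r / p) := by
          gcongr
      _ = ENNReal.ofReal (δ ^ r * (C * δ ^ (-(N + α * p))) ^ (r / p)) * I ^ (r / p) := by
          rw [ENNReal.mul_rpow_of_nonneg _ _ hrp, ENNReal.ofReal_rpow_of_nonneg (by positivity) hrp,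
            ← mul_assoc, ← ENNReal.ofReal_mul (by positivity)]
      _ ≤ ENNReal.ofReal (C ^ (r / p) * d ^ e * (δ ^ N)⁻¹) * (A ^ (r / p - 1) * I) := by gcongr
      _ = _ := by
          rw [ENNReal.ofReal_mul (by positivity)]
          ring
  have hmeas := measurable_indicator_weightedHess (p := p) (α := α) hΩ hh hp0.le hα
  by_cases hAtop : A = ⊤
  · rw [hAtop, ENNReal.top_rpow_of_pos (div_pos hr0 hp0), ENNReal.mul_top]
    · exact le_top
    · rw [ne_eq, ENNReal.ofReal_eq_zero, not_le]
      positivity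
  refine (setLIntegral_mono' hΩ.measurableSet hpt).trans ?_
  have hrp1 : 0 ≤ r / p - 1 := by
    rw [sub_nonneg, one_le_div hp0]
    exact hpr
  rw [lintegral_const_mul' _ _ (ENNReal.mul_ne_top ENNReal.ofReal_ne_top
    (ENNReal.rpow_ne_top_of_nonneg hrp1 hAtop))]
  calc _ ≤ ENNReal.ofReal (C ^ (r / p) * d ^ e) * A ^ (r / p - 1) *
        (ENNReal.ofReal ((3 / 2) ^ N * V) * A) := by
        gcongr
        exact lintegral_whitney_average_le hΩ hf hmeas
    _ = ENNReal.ofReal (C ^ (r / p) * d ^ e * ((3 / 2) ^ N * V)) * A ^ (r / p) := by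
        have : A ^ (r / p) = A ^ (r / p - 1) * A := by
          conv_rhs => rw [← ENNReal.rpow_one A, ← ENNReal.rpow_mul, one_mul]
          rw [← ENNReal.rpow_add_of_nonneg _ _ hrp1 zero_le_one, sub_add_cancel]
        rw [this, ENNReal.ofReal_mul (p := C ^ (r / p) * d ^ e) (by positivity)]
        ring
    _ ≤ _ := by
        gcongr
        linarith

end WeightedBounds

section Transport

variable {N : ℕ} {Ω : Set (Euc N)}

lemma norm_rpow_le_add_integral {E : Type*} [NormedAddCommGroup E] [InnerProductSpace ℝ E]
    [CompleteSpace E] {φ φ' : ℝ → E} {r : ℝ} (hr : 1 ≤ r)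
    (hφ : ∀ t ∈ Icc (0 : ℝ) 1, HasDerivAt φ (φ' t) t) (hφ' : ContinuousOn φ' (Icc 0 1)) :
    ‖φ 0‖ ^ r ≤ ‖φ 1‖ ^ r + ∫ t in (0 : ℝ)..1, r * (‖φ t‖ ^ (r - 1) * ‖φ' t‖) := by
  have hφc : ContinuousOn φ (Icc 0 1) := fun t ht => (hφ t ht).continuousAt.continuousWithinAt
  rcases hr.eq_or_lt with rfl | hr
  · have hintegrable : IntervalIntegrable φ' volume 0 1 :=
      ContinuousOn.intervalIntegrable (by rwa [uIcc_of_le zero_le_one])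
    have h1 : ∫ t in (0 : ℝ)..1, φ' t = φ 1 - φ 0 :=
      intervalIntegral.integral_eq_sub_of_hasDerivAt
        (fun t ht => hφ t (by rwa [uIcc_of_le zero_le_one] at ht)) hintegrable
    have h2 := intervalIntegral.norm_integral_le_integral_norm (f := φ') (μ := volume)
      (zero_le_one (α := ℝ))
    rw [h1] at h2
    have h3 : ‖φ 0‖ ≤ ‖φ 1‖ + ‖φ 1 - φ 0‖ := norm_le_norm_add_norm_sub _ _
    simp only [rpow_one, sub_self, rpow_zero, one_mul]
    linarith
  · have hcont : ContinuousOn (fun t => r * (‖φ t‖ ^ (r - 1) * ‖φ' t‖)) (Icc 0 1) :=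
      continuousOn_const.mul ((hφc.norm.rpow_const fun _ _ => Or.inr (by linarith)).mul hφ'.norm)
    have key := intervalIntegral.sub_le_integral_of_hasDeriv_right_of_le (a := 0) (b := 1)
      (g := fun t => -‖φ t‖ ^ r)
      (g' := fun t => -((r * ‖φ t‖ ^ (r - 2)) • innerSL ℝ (φ t)) (φ' t))
      (φ := fun t => r * (‖φ t‖ ^ (r - 1) * ‖φ' t‖)) zero_le_one
      (hφc.norm.rpow_const fun _ _ => Or.inr (by linarith)).neg
      (fun t ht => (((hasFDerivAt_norm_rpow (φ t) hr).comp_hasDerivAt t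
        (hφ t (Ioo_subset_Icc_self ht))).neg).hasDerivWithinAt)
      hcont.integrableOn_Icc ?_
    · linarith
    · intro t _
      have h1 : -((r * ‖φ t‖ ^ (r - 2)) • innerSL ℝ (φ t)) (φ' t) =
          r * ‖φ t‖ ^ (r - 2) * -inner ℝ (φ t) (φ' t) := by simp
      rw [h1]
      have h2 : -inner ℝ (φ t) (φ' t) ≤ ‖φ t‖ * ‖φ' t‖ :=
        (neg_le_abs _).trans (abs_real_inner_le_norm _ _)
      rcases eq_or_ne (φ t) 0 with h0 | h0
      · simp only [h0, inner_zero_left, neg_zero, mul_zero]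
        positivity
      · have h3 : ‖φ t‖ ^ (r - 1) = ‖φ t‖ ^ (r - 2) * ‖φ t‖ := by
          rw [← rpow_add_one (norm_ne_zero_iff.2 h0)]
          congr 1
          ring
        rw [h3, mul_assoc, mul_assoc]
        gcongr

lemma ofReal_norm_rpow_le_add_lintegral {V : Euc N → Euc N} (hΩ : IsOpen Ω)
    (hV : ContDiffOn ℝ 1 V Ω) {r : ℝ} (hr : 1 ≤ r) {w e : Euc N}
    (hw : ∀ t ∈ Icc (0 : ℝ) 1, w + t • e ∈ Ω) :
    ENNReal.ofReal (‖V w‖ ^ r) ≤ ENNReal.ofReal (‖V (w + e)‖ ^ r) +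
      ∫⁻ t in Icc (0 : ℝ) 1, ENNReal.ofReal
        (r * ‖e‖ * (‖V (w + t • e)‖ ^ (r - 1) * ‖fderiv ℝ V (w + t • e)‖)) := by
  have hline : Continuous fun t : ℝ => w + t • e := by fun_prop
  have hD : ContinuousOn (fun t : ℝ => fderiv ℝ V (w + t • e)) (Icc 0 1) :=
    (hV.continuousOn_fderiv_of_isOpen hΩ le_rfl).comp hline.continuousOn hw
  have hVl : ContinuousOn (fun t : ℝ => V (w + t • e)) (Icc 0 1) :=
    hV.continuousOn.comp hline.continuousOn hw
  have h1 := norm_rpow_le_add_integral (φ := fun t : ℝ => V (w + t • e))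
    (φ' := fun t => fderiv ℝ V (w + t • e) e) hr
    (fun t ht => by
      have hd : HasDerivAt (fun t : ℝ => w + t • e) e t := by
        simpa using ((hasDerivAt_id t).smul_const e).const_add w
      exact ((hV.contDiffAt (hΩ.mem_nhds (hw t ht))).differentiableAt
        one_ne_zero).hasFDerivAt.comp_hasDerivAt t hd)
    (hD.clm_apply continuousOn_const)
  have hcont : ContinuousOn (fun t : ℝ => r * ‖e‖ *
      (‖V (w + t • e)‖ ^ (r - 1) * ‖fderiv ℝ V (w + t • e)‖)) (Icc 0 1) :=
    continuousOn_const.mul ((hVl.norm.rpow_const fun _ _ => Or.inr (by linarith)).mul hD.norm)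
  have hcont' : ContinuousOn (fun t : ℝ => r *
      (‖V (w + t • e)‖ ^ (r - 1) * ‖fderiv ℝ V (w + t • e) e‖)) (Icc 0 1) :=
    continuousOn_const.mul ((hVl.norm.rpow_const fun _ _ => Or.inr (by linarith)).mul
      (hD.clm_apply continuousOn_const).norm)
  have h2 : ∫ t in (0 : ℝ)..1, r * (‖V (w + t • e)‖ ^ (r - 1) * ‖fderiv ℝ V (w + t • e) e‖) ≤
      ∫ t in Icc (0 : ℝ) 1, r * ‖e‖ *
        (‖V (w + t • e)‖ ^ (r - 1) * ‖fderiv ℝ V (w + t • e)‖) := by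
    rw [intervalIntegral.integral_of_le zero_le_one, ← integral_Icc_eq_integral_Ioc]
    refine setIntegral_mono_on hcont'.integrableOn_Icc hcont.integrableOn_Icc measurableSet_Icc
      fun t _ => ?_
    calc _ ≤ r * (‖V (w + t • e)‖ ^ (r - 1) * (‖fderiv ℝ V (w + t • e)‖ * ‖e‖)) := by
          gcongr
          exact ContinuousLinearMap.le_opNorm _ _
      _ = _ := by ring
  rw [← ofReal_integral_eq_lintegral_ofReal hcont.integrableOn_Icc
    (Filter.Eventually.of_forall fun t => by positivity), ← ENNReal.ofReal_add (by positivity)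
    (integral_nonneg fun t => by positivity)]
  refine ENNReal.ofReal_le_ofReal ?_
  simp only [zero_smul, add_zero, one_smul] at h1
  linarith

/-- Moving a patch inward costs only a term weighted by the distance to the boundary. -/
lemma lintegral_norm_rpow_le_of_shift {V : Euc N → Euc N} (hΩ : IsOpen Ω)
    (hf : (frontier Ω).Nonempty) (hV : ContDiffOn ℝ 1 V Ω) {r : ℝ} (hr : 1 ≤ r)
    {U : Set (Euc N)} (hU : MeasurableSet U) {e : Euc N} {σ : ℝ} (hσ : 0 < σ)
    (hmem : ∀ w ∈ U, ∀ t ∈ Icc (0 : ℝ) 1, w + t • e ∈ Ω)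
    (hball : ∀ w ∈ U, ∀ t ∈ Icc (0 : ℝ) 1, ball (w + t • e) (t * σ) ⊆ Ω) :
    ∫⁻ x in U, ENNReal.ofReal (‖V x‖ ^ r) ≤
      (∫⁻ x in U, ENNReal.ofReal (‖V (x + e)‖ ^ r)) + ENNReal.ofReal (r * ‖e‖ / σ) *
        ∫⁻ x in Ω, ENNReal.ofReal
          (‖V x‖ ^ (r - 1) * (infDist x (frontier Ω) * ‖fderiv ℝ V x‖)) := by
  set K : Euc N → ENNReal := Ω.indicator fun y => ENNReal.ofReal
    (r * ‖e‖ * (‖V y‖ ^ (r - 1) * ‖fderiv ℝ V y‖)) with hK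
  have hKm : Measurable K := measurable_indicator_ofReal hΩ <|
    continuousOn_const.mul ((hV.continuousOn.norm.rpow_const fun _ _ => Or.inr (by linarith)).mul
      (hV.continuousOn_fderiv_of_isOpen hΩ le_rfl).norm)
  have hpt : ∀ w ∈ U, ENNReal.ofReal (‖V w‖ ^ r) ≤ ENNReal.ofReal (‖V (w + e)‖ ^ r) +
      ∫⁻ t in Icc (0 : ℝ) 1, K (w + t • e) := by
    intro w hw
    refine (ofReal_norm_rpow_le_add_lintegral hΩ hV hr (hmem w hw)).trans (le_of_eq ?_)
    congr 1
    refine setLIntegral_congr_fun measurableSet_Icc fun t ht => ?_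
    rw [hK, indicator_of_mem (hmem w hw t ht)]
  have hmeas2 : Measurable fun q : Euc N × ℝ => K (q.1 + q.2 • e) := hKm.comp (by fun_prop)
  have hswap : ∫⁻ w in U, ∫⁻ t in Icc (0 : ℝ) 1, K (w + t • e) ≤
      ENNReal.ofReal (r * ‖e‖ / σ) * ∫⁻ x in Ω, ENNReal.ofReal
          (‖V x‖ ^ (r - 1) * (infDist x (frontier Ω) * ‖fderiv ℝ V x‖)) := by
    set S : Set (Euc N × ℝ) := {q | q.1 - q.2 • e ∈ U} with hS
    have hSm : MeasurableSet S :=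
      (by fun_prop : Measurable fun q : Euc N × ℝ => q.1 - q.2 • e) hU
    have hKS : Measurable (S.indicator fun q => K q.1) := (hKm.comp measurable_fst).indicator hSm
    calc ∫⁻ w in U, ∫⁻ t in Icc (0 : ℝ) 1, K (w + t • e)
        = ∫⁻ t in Icc (0 : ℝ) 1, ∫⁻ w in U, K (w + t • e) :=
          lintegral_lintegral_swap hmeas2.aemeasurable
      _ = ∫⁻ t in Icc (0 : ℝ) 1, ∫⁻ y, S.indicator (fun q => K q.1) (y, t) := by
          refine lintegral_congr fun t => ?_
          rw [← lintegral_indicator hU,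
            ← lintegral_add_right_eq_self (fun y => S.indicator (fun q => K q.1) (y, t)) (t • e)]
          refine lintegral_congr fun w => ?_
          by_cases hw : w ∈ U
          · have : (w + t • e, t) ∈ S := by simpa [hS] using hw
            rw [indicator_of_mem hw, indicator_of_mem this]
          · have : (w + t • e, t) ∉ S := by simpa [hS] using hw
            rw [indicator_of_notMem hw, indicator_of_notMem this]
      _ = ∫⁻ y, ∫⁻ t in Icc (0 : ℝ) 1, S.indicator (fun q => K q.1) (y, t) :=
          (lintegral_lintegral_swap (f := fun y t => S.indicator (fun q => K q.1) (y, t))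
            hKS.aemeasurable).symm
      _ ≤ ∫⁻ y, K y * ENNReal.ofReal (infDist y (frontier Ω) / σ) := by
          refine lintegral_mono fun y => ?_
          have hle : ∀ t ∈ Icc (0 : ℝ) 1, S.indicator (fun q => K q.1) (y, t) ≤
              (Icc 0 (infDist y (frontier Ω) / σ)).indicator (fun _ => K y) t := by
            intro t ht
            by_cases hy : (y, t) ∈ S
            · have h1 := hball _ hy t ht
              rw [sub_add_cancel] at h1
              have h2 := le_infDist_frontier hΩ hf h1
              rw [indicator_of_mem hy, indicator_of_mem]
              exact ⟨ht.1, by rwa [le_div_iff₀ hσ]⟩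
            · rw [indicator_of_notMem hy]
              exact zero_le
          refine (setLIntegral_mono' measurableSet_Icc hle).trans
            ((setLIntegral_le_lintegral _ _).trans ?_)
          rw [lintegral_indicator_const measurableSet_Icc, volume_Icc, sub_zero]
      _ = ∫⁻ y in Ω, ENNReal.ofReal (r * ‖e‖ / σ) * ENNReal.ofReal
          (‖V y‖ ^ (r - 1) * (infDist y (frontier Ω) * ‖fderiv ℝ V y‖)) := by
          rw [← lintegral_indicator hΩ.measurableSet]
          refine lintegral_congr fun y => ?_
          by_cases hy : y ∈ Ω
          · rw [hK, indicator_of_mem hy, indicator_of_mem hy, ← ENNReal.ofReal_mul (by positivity),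
              ← ENNReal.ofReal_mul (by positivity)]
            congr 1
            ring
          · rw [hK, indicator_of_notMem hy, indicator_of_notMem hy, zero_mul]
      _ = _ := lintegral_const_mul' _ _ ENNReal.ofReal_ne_top
  have hinner : Measurable fun w => ∫⁻ t in Icc (0 : ℝ) 1, K (w + t • e) :=
    hmeas2.lintegral_prod_right'
  calc _ ≤ ∫⁻ x in U, (ENNReal.ofReal (‖V (x + e)‖ ^ r) +
        ∫⁻ t in Icc (0 : ℝ) 1, K (x + t • e)) := setLIntegral_mono' hU hpt
    _ = (∫⁻ x in U, ENNReal.ofReal (‖V (x + e)‖ ^ r)) +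
        ∫⁻ x in U, ∫⁻ t in Icc (0 : ℝ) 1, K (x + t • e) := lintegral_add_right _ hinner
    _ ≤ _ := by gcongr

lemma rpow_sub_one_mul_le {a b ε r : ℝ} (ha : 0 ≤ a) (hb : 0 ≤ b) (hε : 0 < ε) (hr : 1 ≤ r) :
    a ^ (r - 1) * b ≤ ε * a ^ r + ε ^ (1 - r) * b ^ r := by
  have hr1 : 0 ≤ r - 1 := by linarith
  have hsplit : ∀ {c : ℝ}, 0 ≤ c → c ^ r = c ^ (r - 1) * c := fun {c} hc => by
    nth_rw 3 [← rpow_one c]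
    rw [← rpow_add_of_nonneg hc hr1 zero_le_one, sub_add_cancel]
  rcases le_total b (ε * a) with h | h
  · calc a ^ (r - 1) * b ≤ a ^ (r - 1) * (ε * a) := by gcongr
      _ = ε * a ^ r := by rw [hsplit ha]; ring
      _ ≤ _ := le_add_of_nonneg_right (by positivity)
  · have h1 : a ≤ b / ε := by rwa [le_div_iff₀ hε, mul_comm]
    calc a ^ (r - 1) * b ≤ (b / ε) ^ (r - 1) * b := by gcongr
      _ = ε ^ (1 - r) * b ^ r := by
        rw [hsplit hb, div_rpow hb hε.le, ← neg_sub r 1, rpow_neg hε.le]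
        ring
      _ ≤ _ := le_add_of_nonneg_left (by positivity)

end Transport

section Gradient

variable {N : ℕ} {Ω : Set (Euc N)}

lemma contDiffOn_gradient {h : Euc N → ℝ} (hΩ : IsOpen Ω) (hh : ContDiffOn ℝ 2 h Ω) :
    ContDiffOn ℝ 1 (gradient h) Ω :=
  ((InnerProductSpace.toDual ℝ (Euc N)).symm.toContinuousLinearEquiv.contDiff.comp_contDiffOn
    (hh.fderiv_of_isOpen (m := 1) hΩ (by norm_num)))

lemma gradient_apply (h : Euc N → ℝ) (x : Euc N) (j : Fin N) :
    gradient h x j = fderiv ℝ h x (EuclideanSpace.single j (1 : ℝ)) := by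
  rw [← inner_single_eq, gradient, InnerProductSpace.toDual_symm_apply]

lemma norm_fderiv_gradient_le {h : Euc N → ℝ} (hΩ : IsOpen Ω) (hh : ContDiffOn ℝ 2 h Ω)
    {x : Euc N} (hx : x ∈ Ω) : ‖fderiv ℝ (gradient h) x‖ ≤ √(hessNormSq h x) := by
  refine ContinuousLinearMap.opNorm_le_bound _ (sqrt_nonneg _) fun v => ?_
  have hV : DifferentiableAt ℝ (gradient h) x :=
    ((contDiffOn_gradient hΩ hh).contDiffAt (hΩ.mem_nhds hx)).differentiableAt one_ne_zero
  have hcomp : ∀ j, fderiv ℝ (gradient h) x v j = ∑ i, v i * hessEntry h x i j := by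
    intro j
    have h1 : fderiv ℝ (fun y => fderiv ℝ h y (EuclideanSpace.single j (1 : ℝ))) x v =
        fderiv ℝ (gradient h) x v j := by
      have h2 : (fun y => fderiv ℝ h y (EuclideanSpace.single j (1 : ℝ))) =
          fun y => EuclideanSpace.proj (𝕜 := ℝ) j (gradient h y) := by
        ext y
        exact (gradient_apply h y j).symm
      rw [h2]
      have h3 := ((EuclideanSpace.proj (𝕜 := ℝ) j : Euc N →L[ℝ] ℝ).hasFDerivAt.comp x
        hV.hasFDerivAt).fderiv
      exact congrArg (fun L => L v) h3
    rw [← h1, clm_apply_eq_sum]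
    rfl
  rw [EuclideanSpace.norm_eq, EuclideanSpace.norm_eq, ← sqrt_mul' _ (by positivity)]
  refine sqrt_le_sqrt ?_
  simp only [norm_eq_abs, sq_abs, hcomp]
  calc ∑ j, (∑ i, v i * hessEntry h x i j) ^ 2
      ≤ ∑ j, (∑ i, v i ^ 2) * ∑ i, hessEntry h x i j ^ 2 :=
        Finset.sum_le_sum fun j _ => Finset.sum_mul_sq_le_sq_mul_sq _ _ _
    _ = hessNormSq h x * ∑ i, v i ^ 2 := by
        rw [← Finset.mul_sum, Finset.sum_comm, mul_comm, hessNormSq]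

end Gradient

section Oscillation

variable {N : ℕ} {Ω : Set (Euc N)}

lemma sub_le_card_mul_of_cover {X ι : Type*} [TopologicalSpace X] {S : Set X}
    (hS : IsPreconnected S) {f : X → ℝ} (hf : ContinuousOn f S) {T : Finset ι} {P : ι → Set X}
    (hcov : S ⊆ ⋃ c ∈ T, P c) {D : ℝ} (hD : 0 ≤ D)
    (hosc : ∀ c ∈ T, ∀ x ∈ S ∩ P c, ∀ y ∈ S ∩ P c, |f x - f y| ≤ D) {x y : X} (hx : x ∈ S)
    (hy : y ∈ S) : f y - f x ≤ T.card * D := by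
  have hsub : Icc (f x) (f y) ⊆ ⋃ c ∈ T, f '' (S ∩ P c) := by
    intro s hs
    obtain ⟨q, hq, rfl⟩ := (hS.image f hf).Icc_subset (mem_image_of_mem f hx)
      (mem_image_of_mem f hy) hs
    obtain ⟨c, hc, hqc⟩ := mem_iUnion₂.1 (hcov hq)
    exact mem_iUnion₂.2 ⟨c, hc, q, ⟨hq, hqc⟩, rfl⟩
  have h1 : volume (Icc (f x) (f y)) ≤ ENNReal.ofReal (T.card * D) := by
    refine (measure_mono hsub).trans ((measure_biUnion_finset_le T _).trans ?_)
    calc ∑ c ∈ T, volume (f '' (S ∩ P c)) ≤ ∑ c ∈ T, ENNReal.ofReal D := by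
          refine Finset.sum_le_sum fun c hc => (Real.volume_le_diam _).trans ?_
          refine Metric.ediam_le ?_
          rintro _ ⟨u, hu, rfl⟩ _ ⟨v, hv, rfl⟩
          rw [edist_dist, Real.dist_eq]
          exact ENNReal.ofReal_le_ofReal (hosc c hc u hu v hv)
      _ = _ := by
          rw [Finset.sum_const, nsmul_eq_mul, ENNReal.ofReal_mul (by positivity),
            ENNReal.ofReal_natCast]
  rw [volume_Icc] at h1
  exact (ENNReal.ofReal_le_ofReal_iff (by positivity)).1 h1

lemma norm_sub_le_of_joinedIn_deepSet {V : Euc N → Euc N} (hΩ : IsOpen Ω)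
    (hV : ContDiffOn ℝ 1 V Ω) {σ B : ℝ} (hσ : 0 < σ) (hB : 0 ≤ B)
    (hle : ∀ x ∈ deepSet Ω (σ / 2), ‖fderiv ℝ V x‖ ≤ B) {T : Finset (Euc N)}
    (hcov : Ω ⊆ ⋃ c ∈ T, ball c (σ / 4)) {m z : Euc N} (hj : JoinedIn (deepSet Ω σ) m z) :
    ‖V z - V m‖ ≤ T.card * (B * (σ / 2)) := by
  obtain ⟨γ, hγ⟩ := hj
  have hdeep : deepSet Ω σ ⊆ Ω := fun x hx => hx (mem_ball_self hσ)
  have hrange : range γ ⊆ deepSet Ω σ := range_subset_iff.2 hγ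
  have hlip : ∀ x ∈ deepSet Ω σ, ∀ y, dist x y ≤ σ / 2 → ‖V x - V y‖ ≤ B * (σ / 2) := by
    intro x hx y hxy
    have hsub : closedBall x (σ / 2) ⊆ deepSet Ω (σ / 2) := by
      intro w hw
      refine Subset.trans (ball_subset_ball' ?_) hx
      rw [mem_closedBall] at hw
      linarith
    have hmvt := (convex_closedBall x (σ / 2)).norm_image_sub_le_of_norm_fderiv_le (𝕜 := ℝ)
      (f := V) (C := B) (x := y) (y := x)
      (fun w hw => (hV.contDiffAt (hΩ.mem_nhds
        (hsub hw (mem_ball_self (half_pos hσ))))).differentiableAt one_ne_zero)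
      (fun w hw => hle w (hsub hw)) (by rwa [mem_closedBall, dist_comm])
      (mem_closedBall_self (half_pos hσ).le)
    rw [← dist_eq_norm x y] at hmvt
    exact hmvt.trans (by gcongr)
  have h := sub_le_card_mul_of_cover (S := range γ) (isPreconnected_range γ.continuous)
    (f := fun w => ‖V w - V m‖) ((hV.continuousOn.mono (hrange.trans hdeep)).sub
      continuousOn_const).norm (hrange.trans (hdeep.trans hcov))
    (D := B * (σ / 2)) (by positivity) (fun c _ x hx y hy => by
      refine (abs_norm_sub_norm_le _ _).trans ?_
      rw [sub_sub_sub_cancel_right]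
      refine hlip x (hrange hx.1) y ?_
      have h1 : dist x c < σ / 4 := hx.2
      have h2 : dist y c < σ / 4 := hy.2
      linarith [dist_triangle_right x y c])
    (x := m) (y := z) ⟨0, γ.source⟩ ⟨1, γ.target⟩
  simpa using h

end Oscillation

section MeanZero

variable {N : ℕ} {Ω : Set (Euc N)}

lemma setIntegral_lineDeriv_eq_zero_of_nonneg (hb : Bornology.IsBounded Ω)
    {f : Euc N → ℝ} {C : NNReal} (hf : LipschitzWith C f) (h0 : ∀ x ∉ Ω, f x = 0)
    (hpos : ∀ x, 0 ≤ f x) (v : Euc N) : ∫ x in Ω, lineDeriv ℝ f x v = 0 := by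
  have hsupp : HasCompactSupport f :=
    HasCompactSupport.intro' hb.isCompact_closure isClosed_closure
      fun x hx => h0 x fun hxΩ => hx (subset_closure hxΩ)
  have hzero : ∀ x ∉ Ω, lineDeriv ℝ f x v = 0 := fun x hx => by
    have hmin : IsLocalMin f x := Filter.Eventually.of_forall fun y => by
      rw [h0 x hx]
      exact hpos y
    rw [hmin.lineDeriv_eq_zero, Pi.zero_apply]
  rw [setIntegral_eq_integral_of_forall_compl_eq_zero hzero]
  have h1 := LipschitzWith.integral_lineDeriv_mul_eq (μ := volume) (LipschitzWith.const (1 : ℝ)) hf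
    hsupp (-v)
  have hconst : ∀ x, lineDeriv ℝ (fun _ : Euc N => (1 : ℝ)) x (-v) = 0 := fun x => by
    simp [lineDeriv]
  simp only [hconst, zero_mul, integral_zero, neg_neg, mul_one] at h1
  exact h1.symm

lemma setIntegral_lineDeriv_eq_zero (hb : Bornology.IsBounded Ω)
    {f : Euc N → ℝ} {C : NNReal} (hf : LipschitzWith C f) (h0 : ∀ x ∉ Ω, f x = 0)
    (v : Euc N) : ∫ x in Ω, lineDeriv ℝ f x v = 0 := by
  have hfin : IsFiniteMeasure (volume.restrict Ω) := ⟨by simpa using hb.measure_lt_top⟩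
  have hf₁ : LipschitzWith C fun x => max (f x) 0 := hf.max_const 0
  have hf₂ : LipschitzWith C fun x => max (-f x) 0 := hf.neg.max_const 0
  have h₁ := setIntegral_lineDeriv_eq_zero_of_nonneg hb hf₁ (fun x hx => by simp [h0 x hx])
    (fun x => le_max_right _ _) v
  have h₂ := setIntegral_lineDeriv_eq_zero_of_nonneg hb hf₂ (fun x hx => by simp [h0 x hx])
    (fun x => le_max_right _ _) v
  have hintegrable₁ : Integrable (fun x => lineDeriv ℝ (fun x => max (f x) 0) x v)
    (volume.restrict Ω) := (hf₁.memLp_lineDeriv v).integrable le_top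
  have hintegrable₂ : Integrable (fun x => lineDeriv ℝ (fun x => max (-f x) 0) x v)
    (volume.restrict Ω) := (hf₂.memLp_lineDeriv v).integrable le_top
  have hsub : (fun x => lineDeriv ℝ f x v) =ᵐ[volume.restrict Ω] fun x =>
      lineDeriv ℝ (fun x => max (f x) 0) x v - lineDeriv ℝ (fun x => max (-f x) 0) x v := by
    refine ae_restrict_of_ae ?_
    filter_upwards [hf₁.ae_lineDifferentiableAt v, hf₂.ae_lineDifferentiableAt v] with x hx₁ hx₂
    have h3 : HasLineDerivAt ℝ (fun y => max (f y) 0 - max (-f y) 0)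
        (lineDeriv ℝ (fun x => max (f x) 0) x v - lineDeriv ℝ (fun x => max (-f x) 0) x v) x v :=
      HasDerivAt.sub hx₁.hasLineDerivAt hx₂.hasLineDerivAt
    have h4 : (fun y => max (f y) 0 - max (-f y) 0) = f := by
      ext y
      rcases le_total (f y) 0 with h | h
      · rw [max_eq_right h, max_eq_left (by linarith)]
        ring
      · rw [max_eq_left h, max_eq_right (by linarith)]
        ring
    rw [h4] at h3
    exact h3.lineDeriv
  rw [integral_congr_ae hsub, integral_sub hintegrable₁ hintegrable₂, h₁, h₂, sub_zero]

/-- A function vanishing on the boundary grows at most linearly in the distance to it. -/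
lemma abs_le_mul_infDist {u : Euc N → ℝ} {L : ℝ} (hΩ : IsOpen Ω) (hf : (frontier Ω).Nonempty)
    (hu : ContinuousOn u (closure Ω)) (hd : DifferentiableOn ℝ u Ω) (h0 : ∀ x ∈ frontier Ω, u x = 0)
    (hL : ∀ x ∈ Ω, ‖fderiv ℝ u x‖ ≤ L) {x : Euc N} (hx : x ∈ Ω) :
    |u x| ≤ L * infDist x (frontier Ω) := by
  obtain ⟨q, hq, hqd⟩ := isClosed_frontier.exists_infDist_eq_dist hf x
  have hball := ball_infDist_frontier_subset hΩ hx
  have hδ := infDist_frontier_pos hΩ hf hx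
  have hmem : ∀ t ∈ Ico (0 : ℝ) 1, x + t • (q - x) ∈ Ω := by
    intro t ht
    refine hball ?_
    rw [mem_ball, dist_eq_norm, add_sub_cancel_left, norm_smul, norm_of_nonneg ht.1,
      ← dist_eq_norm, dist_comm, ← hqd]
    exact mul_lt_of_lt_one_left hδ ht.2
  have hmem' : ∀ t ∈ Icc (0 : ℝ) 1, x + t • (q - x) ∈ closure Ω := by
    intro t ht
    rcases ht.2.eq_or_lt with rfl | h1
    · rw [one_smul, add_sub_cancel]
      exact frontier_subset_closure hq
    · exact subset_closure (hmem t ⟨ht.1, h1⟩)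
  have hline : Continuous fun t : ℝ => x + t • (q - x) := by fun_prop
  have key := norm_image_sub_le_of_norm_deriv_right_le_segment (a := (0 : ℝ)) (b := 1)
    (f := fun t : ℝ => u (x + t • (q - x)))
    (f' := fun t => fderiv ℝ u (x + t • (q - x)) (q - x)) (C := L * infDist x (frontier Ω))
    (hu.comp hline.continuousOn hmem')
    (fun t ht => by
      have hdt : HasDerivAt (fun t : ℝ => x + t • (q - x)) (q - x) t := by
        simpa using ((hasDerivAt_id t).smul_const (q - x)).const_add x
      exact (((hd _ (hmem t ht)).differentiableAt
        (hΩ.mem_nhds (hmem t ht))).hasFDerivAt.comp_hasDerivAt t hdt).hasDerivWithinAt)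
    (fun t ht => by
      rw [hqd, dist_comm, dist_eq_norm]
      exact (ContinuousLinearMap.le_opNorm _ _).trans (by gcongr; exact hL _ (hmem t ht))) 1
    (right_mem_Icc.2 zero_le_one)
  simpa [h0 q hq] using key

/-- The gradient of a function vanishing on the boundary has mean zero. -/
lemma setIntegral_fderiv_apply_eq_zero {u : Euc N → ℝ} {L : ℝ} (hΩ : IsOpen Ω)
    (hb : Bornology.IsBounded Ω) (hf : (frontier Ω).Nonempty) (hu : ContinuousOn u (closure Ω))
    (hd : DifferentiableOn ℝ u Ω) (h0 : ∀ x ∈ frontier Ω, u x = 0)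
    (hL : ∀ x ∈ Ω, ‖fderiv ℝ u x‖ ≤ L) (v : Euc N) : ∫ x in Ω, fderiv ℝ u x v = 0 := by
  rcases Ω.eq_empty_or_nonempty with rfl | ⟨x₀, hx₀⟩
  · simp
  have hL0 : 0 ≤ L := (norm_nonneg _).trans (hL x₀ hx₀)
  have hbd : ∀ x ∈ Ω, |u x| ≤ L * infDist x (frontier Ω) := fun x hx =>
    abs_le_mul_infDist hΩ hf hu hd h0 hL hx
  have hclose : ∀ x ∈ Ω, ∀ y, infDist x (frontier Ω) ≤ dist x y →
      |Ω.indicator u x - Ω.indicator u y| ≤ 3 * L * dist x y := by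
    intro x hx y hxy
    have h1 := hbd x hx
    have h2 : L * infDist x (frontier Ω) ≤ L * dist x y := by gcongr
    have h4 : 0 ≤ L * dist x y := by positivity
    rw [indicator_of_mem hx]
    by_cases hy : y ∈ Ω
    · have h3 : infDist y (frontier Ω) ≤ 2 * dist x y := by
        have := infDist_le_infDist_add_dist (x := y) (y := x) (s := frontier Ω)
        rw [dist_comm y x] at this
        linarith
      have h5 := hbd y hy
      have h6 : L * infDist y (frontier Ω) ≤ L * (2 * dist x y) := by gcongr
      rw [indicator_of_mem hy]
      have h7 := abs_sub (u x) (u y)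
      linarith
    · rw [indicator_of_notMem hy, sub_zero]
      linarith
  have hlip : LipschitzWith (3 * L).toNNReal (Ω.indicator u) := by
    refine LipschitzWith.of_dist_le_mul fun x y => ?_
    rw [coe_toNNReal _ (by positivity), Real.dist_eq]
    by_cases hx : x ∈ Ω
    · rcases le_or_gt (infDist x (frontier Ω)) (dist x y) with h | h
      · exact hclose x hx y h
      · have hball := ball_infDist_frontier_subset hΩ hx
        have hyb : y ∈ ball x (infDist x (frontier Ω)) := by rwa [mem_ball, dist_comm]
        rw [indicator_of_mem hx, indicator_of_mem (hball hyb)]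
        have h1 := (convex_ball x (infDist x (frontier Ω))).norm_image_sub_le_of_norm_fderiv_le
          (𝕜 := ℝ) (f := u) (C := L) (x := y) (y := x)
          (fun w hw => (hd w (hball hw)).differentiableAt (hΩ.mem_nhds (hball hw)))
          (fun w hw => hL w (hball hw)) hyb (mem_ball_self (infDist_frontier_pos hΩ hf hx))
        rw [← dist_eq_norm x y, norm_eq_abs] at h1
        have h2 : 0 ≤ L * dist x y := by positivity
        linarith
    · by_cases hy : y ∈ Ω
      · rw [abs_sub_comm, dist_comm]
        refine hclose y hy x ?_
        by_contra! h
        exact hx (ball_infDist_frontier_subset hΩ hy (by rwa [mem_ball, dist_comm]))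
      · rw [indicator_of_notMem hx, indicator_of_notMem hy, sub_self, abs_zero]
        positivity
  rw [← setIntegral_lineDeriv_eq_zero hb hlip (fun x hx => indicator_of_notMem hx _) v]
  refine setIntegral_congr_fun hΩ.measurableSet fun x hx => ?_
  have hev : Ω.indicator u =ᶠ[nhds x] u := by
    filter_upwards [hΩ.mem_nhds hx] with y hy using indicator_of_mem hy _
  have hdx : DifferentiableAt ℝ (Ω.indicator u) x :=
    hev.differentiableAt_iff.2 ((hd x hx).differentiableAt (hΩ.mem_nhds hx))
  rw [hdx.lineDeriv_eq_fderiv, hev.fderiv_eq]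

end MeanZero

section MeanZeroBound

lemma enorm_rpow_mul_measure_le {α E : Type*} [MeasurableSpace α] [NormedAddCommGroup E]
    [NormedSpace ℝ E] [CompleteSpace E] {μ : Measure α} [IsFiniteMeasure μ] {f : α → E}
    (hf : Integrable f μ) (h0 : ∫ x, f x ∂μ = 0) {r : ℝ} (hr : 1 ≤ r) (c : E) :
    ‖c‖ₑ ^ r * μ univ ≤ ∫⁻ x, ‖f x - c‖ₑ ^ r ∂μ := by
  have hr0 : 0 < r := by linarith
  rcases eq_or_ne (μ univ) 0 with hμ | hμ
  · simp [hμ]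
  have h1 : ‖c‖ₑ * μ univ ≤ ∫⁻ x, ‖f x - c‖ₑ ∂μ := by
    refine le_trans (le_of_eq ?_) (enorm_integral_le_lintegral_enorm _)
    rw [integral_sub hf (integrable_const c), h0, integral_const, zero_sub, enorm_neg, enorm_smul,
      mul_comm, Real.enorm_eq_ofReal measureReal_nonneg, ofReal_measureReal (measure_ne_top _ _)]
  have h2 := (ENNReal.rpow_le_rpow h1 hr0.le).trans
    (lintegral_rpow_le_mul hr (hf.sub (integrable_const c)).aestronglyMeasurable.enorm)
  have hsplit : μ univ ^ r = μ univ ^ (r - 1) * μ univ := by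
    conv_rhs => rw [← ENNReal.rpow_one (μ univ), ← ENNReal.rpow_mul, one_mul]
    rw [← ENNReal.rpow_add _ _ hμ (measure_ne_top _ _), sub_add_cancel]
  rw [ENNReal.mul_rpow_of_nonneg _ _ hr0.le, hsplit, mul_left_comm] at h2
  refine (ENNReal.mul_le_mul_iff_right ?_ ?_).1 h2
  · exact (ENNReal.rpow_pos (pos_iff_ne_zero.2 hμ) (measure_ne_top _ _)).ne'
  · exact ENNReal.rpow_ne_top_of_nonneg (by linarith) (measure_ne_top _ _)

lemma lintegral_enorm_rpow_le_of_integral_eq_zero {α E : Type*} [MeasurableSpace α]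
    [NormedAddCommGroup E] [NormedSpace ℝ E] [CompleteSpace E] {μ : Measure α} [IsFiniteMeasure μ]
    {f : α → E} (hf : Integrable f μ) (h0 : ∫ x, f x ∂μ = 0) {r : ℝ} (hr : 1 ≤ r) (c : E) :
    ∫⁻ x, ‖f x‖ₑ ^ r ∂μ ≤ 2 ^ r * ∫⁻ x, ‖f x - c‖ₑ ^ r ∂μ := by
  have hr0 : 0 ≤ r := by linarith
  calc ∫⁻ x, ‖f x‖ₑ ^ r ∂μ
      ≤ ∫⁻ x, 2 ^ (r - 1) * (‖f x - c‖ₑ ^ r + ‖c‖ₑ ^ r) ∂μ := by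
        refine lintegral_mono fun x => ?_
        refine le_trans ?_ (ENNReal.rpow_add_le_mul_rpow_add_rpow _ _ hr)
        refine ENNReal.rpow_le_rpow ?_ hr0
        calc ‖f x‖ₑ = ‖f x - c + c‖ₑ := by rw [sub_add_cancel]
          _ ≤ _ := enorm_add_le _ _
    _ = 2 ^ (r - 1) * ((∫⁻ x, ‖f x - c‖ₑ ^ r ∂μ) + ‖c‖ₑ ^ r * μ univ) := by
        rw [lintegral_const_mul' _ _ (ENNReal.rpow_ne_top_of_nonneg (by linarith) (by norm_num)),
          lintegral_add_right _ measurable_const, lintegral_const]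
    _ ≤ 2 ^ (r - 1) * ((∫⁻ x, ‖f x - c‖ₑ ^ r ∂μ) + ∫⁻ x, ‖f x - c‖ₑ ^ r ∂μ) := by
        gcongr
        exact enorm_rpow_mul_measure_le hf h0 hr c
    _ = _ := by
        rw [← two_mul, ← mul_assoc]
        congr 1
        conv_lhs => rw [← ENNReal.rpow_one 2, ← ENNReal.rpow_mul, one_mul]
        rw [← ENNReal.rpow_add _ _ (by norm_num) (by norm_num), sub_add_cancel]

end MeanZeroBound

section Covering

lemma exists_finset_ball_cover {E : Type*} [NormedAddCommGroup E] [ProperSpace E] (d : ℝ) {ρ : ℝ}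
    (hρ : 0 < ρ) : ∃ n : ℕ, ∀ Ω : Set E, Bornology.IsBounded Ω → diam Ω ≤ d →
      ∃ T : Finset E, T.card ≤ n ∧ Ω ⊆ ⋃ c ∈ T, ball c ρ := by
  classical
  obtain ⟨t, -, ht, hcov⟩ := (isCompact_closedBall (0 : E) d).finite_cover_balls hρ
  refine ⟨ht.toFinset.card, fun Ω hb hd => ?_⟩
  rcases Ω.eq_empty_or_nonempty with rfl | ⟨x₀, hx₀⟩
  · exact ⟨∅, by simp, empty_subset _⟩
  refine ⟨ht.toFinset.image (· + x₀), Finset.card_image_le, fun x hx => ?_⟩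
  have hx0 : x - x₀ ∈ closedBall (0 : E) d := by
    rw [mem_closedBall_zero_iff, ← dist_eq_norm]
    exact (dist_le_diam_of_mem hb hx hx₀).trans hd
  obtain ⟨c, hc, hxc⟩ := mem_iUnion₂.1 (hcov hx0)
  refine mem_iUnion₂.2 ⟨c + x₀, Finset.mem_image_of_mem _ (ht.mem_toFinset.2 hc), ?_⟩
  rw [mem_ball, dist_eq_norm] at hxc ⊢
  convert hxc using 2
  abel

end Covering

section Patches

variable {N : ℕ} {Ω : Set (Euc N)}

lemma lintegral_norm_rpow_le_of_shift_of_forall_le {V : Euc N → Euc N} (hΩ : IsOpen Ω)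
    (hf : (frontier Ω).Nonempty) (hV : ContDiffOn ℝ 1 V Ω) {r : ℝ} (hr : 1 ≤ r)
    {U : Set (Euc N)} (hU : MeasurableSet U) (hUΩ : U ⊆ Ω) {e : Euc N} {σ ε M : ℝ} (hσ : 0 < σ)
    (hε : 0 < ε) (hM : ∀ x ∈ U, ‖V (x + e)‖ ≤ M)
    (hmem : ∀ w ∈ U, ∀ t ∈ Icc (0 : ℝ) 1, w + t • e ∈ Ω)
    (hball : ∀ w ∈ U, ∀ t ∈ Icc (0 : ℝ) 1, ball (w + t • e) (t * σ) ⊆ Ω) :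
    ∫⁻ x in U, ENNReal.ofReal (‖V x‖ ^ r) ≤
      ENNReal.ofReal (M ^ r) * volume Ω + ENNReal.ofReal (r * ‖e‖ / σ) *
        (ENNReal.ofReal ε * (∫⁻ x in Ω, ENNReal.ofReal (‖V x‖ ^ r)) +
          ENNReal.ofReal (ε ^ (1 - r)) *
            ∫⁻ x in Ω, ENNReal.ofReal ((infDist x (frontier Ω) * ‖fderiv ℝ V x‖) ^ r)) := by
  have hr0 : 0 ≤ r := by linarith
  refine (lintegral_norm_rpow_le_of_shift hΩ hf hV hr hU hσ hmem hball).trans ?_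
  gcongr
  · calc ∫⁻ x in U, ENNReal.ofReal (‖V (x + e)‖ ^ r)
        ≤ ∫⁻ _ in U, ENNReal.ofReal (M ^ r) := by
          refine setLIntegral_mono' hU fun x hx => ENNReal.ofReal_le_ofReal ?_
          exact rpow_le_rpow (norm_nonneg _) (hM x hx) hr0
      _ = ENNReal.ofReal (M ^ r) * volume U := setLIntegral_const _ _
      _ ≤ _ := by gcongr
  · rw [← lintegral_const_mul' _ _ ENNReal.ofReal_ne_top,
      ← lintegral_const_mul' _ _ ENNReal.ofReal_ne_top, ← lintegral_add_left']
    · refine lintegral_mono fun x => ?_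
      rw [← ENNReal.ofReal_mul hε.le, ← ENNReal.ofReal_mul (by positivity),
        ← ENNReal.ofReal_add (by positivity) (mul_nonneg (by positivity)
          (rpow_nonneg (mul_nonneg infDist_nonneg (norm_nonneg _)) _))]
      exact ENNReal.ofReal_le_ofReal (rpow_sub_one_mul_le (norm_nonneg _)
        (mul_nonneg infDist_nonneg (norm_nonneg _)) hε hr)
    · exact ((ContinuousOn.aemeasurable (hV.continuousOn.norm.rpow_const
        fun _ _ => Or.inr hr0) hΩ.measurableSet).ennreal_ofReal).const_mul _

lemma le_two_mul_of_le_add_half {I X : ENNReal} (hI : I ≠ ⊤)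
    (h : I ≤ X + ENNReal.ofReal (1 / 2) * I) : I ≤ 2 * X := by
  rcases eq_or_ne X ⊤ with rfl | hX
  · simp
  lift I to NNReal using hI
  lift X to NNReal using hX
  have h2 : ENNReal.ofReal (1 / 2) = ((1 / 2 : NNReal) : ENNReal) := by
    rw [ENNReal.ofReal, Real.toNNReal_div zero_le_one]
    simp
  rw [h2] at h
  norm_cast at h ⊢
  rw [← NNReal.coe_le_coe] at h ⊢
  push_cast at h ⊢
  linarith

lemma exists_norm_fderiv_gradient_le_of_deepSet (N : ℕ) {p α σ : ℝ} (hp : 1 ≤ p) (hα : 0 ≤ α)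
    (hσ : 0 < σ) :
    ∃ K > (0 : ℝ), ∀ (Ω : Set (Euc N)) (h : Euc N → ℝ), IsOpen Ω → (frontier Ω).Nonempty →
      ContDiffOn ℝ 2 h Ω → (∀ x ∈ Ω, lap h x = 0) →
      (∫⁻ x in Ω, weightedHess Ω h p α x) ≠ ⊤ → ∀ x ∈ deepSet Ω σ,
      ‖fderiv ℝ (gradient h) x‖ ≤
        K * (∫⁻ x in Ω, weightedHess Ω h p α x).toReal ^ (1 / p) := by
  obtain ⟨C, hC, hbound⟩ := exists_hessian_weighted_bound N hp hα
  have hp0 : 0 < p := by linarith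
  refine ⟨(C * σ ^ (-(N + α * p))) ^ (1 / p), by positivity,
    fun Ω h hΩ hf hh hlap hA x hx => ?_⟩
  have hxΩ : x ∈ Ω := hx (mem_ball_self hσ)
  have hδ : σ ≤ infDist x (frontier Ω) := le_infDist_frontier hΩ hf hx
  refine (norm_fderiv_gradient_le hΩ hh hxΩ).trans ?_
  set A := ∫⁻ x in Ω, weightedHess Ω h p α x
  have h1 : ENNReal.ofReal (√(hessNormSq h x) ^ p) ≤
      ENNReal.ofReal (C * σ ^ (-(N + α * p)) * A.toReal) := by
    refine (hbound Ω h hΩ hf hh hlap x hxΩ).trans ?_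
    rw [ENNReal.ofReal_mul (q := A.toReal) (by positivity), ENNReal.ofReal_toReal hA]
    refine mul_le_mul' (ENNReal.ofReal_le_ofReal ?_)
      (lintegral_mono_set (closedBall_half_infDist_subset hΩ hf hxΩ))
    refine mul_le_mul_of_nonneg_left ?_ hC.le
    refine rpow_le_rpow_of_nonpos hσ hδ ?_
    have : 0 ≤ α * p := by positivity
    have : (0 : ℝ) ≤ N := Nat.cast_nonneg N
    linarith
  rw [ENNReal.ofReal_le_ofReal_iff (by positivity)] at h1
  have h2 := rpow_le_rpow (by positivity) h1 (one_div_nonneg.2 hp0.le)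
  rwa [← rpow_mul (sqrt_nonneg _), mul_one_div_cancel hp0.ne', rpow_one,
    mul_rpow (by positivity) ENNReal.toReal_nonneg] at h2

end Patches

section Assembly

variable {N : ℕ}

lemma lintegral_finset_biUnion_le {α ι : Type*} [MeasurableSpace α] {μ : Measure α} (T : Finset ι)
    (s : ι → Set α) (f : α → ENNReal) :
    ∫⁻ x in ⋃ i ∈ T, s i, f x ∂μ ≤ ∑ i ∈ T, ∫⁻ x in s i, f x ∂μ := by
  have h : ⋃ i ∈ T, s i = ⋃ i : T, s i := biUnion_eq_iUnion (T : Set ι) fun i _ => s i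
  rw [h, ← Finset.tsum_subtype T fun i => ∫⁻ x in s i, f x ∂μ]
  exact lintegral_iUnion_le _ _

lemma exists_lintegral_gradient_sub_le (N : ℕ) (hN : 2 ≤ N) {θ a d r p α : ℝ}
    (hθ : θ ∈ Ioc (0 : ℝ) (π / 2)) (ha : 0 < a) (hd : 0 < d) (hp : 1 ≤ p) (hpr : p ≤ r)
    (hα : 0 ≤ α) (hexp : r * (N - p * (1 - α)) ≤ N * p) :
    ∃ C > (0 : ℝ), ∀ (Ω : Set (Euc N)) (h : Euc N → ℝ), IsOpen Ω → IsConnected Ω →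
      Bornology.IsBounded Ω → diam Ω ≤ d → UnifConeCond θ a Ω → ContDiffOn ℝ 2 h Ω →
      (∀ x ∈ Ω, lap h x = 0) → (∃ L, ∀ x ∈ Ω, ‖gradient h x‖ ≤ L) →
      ∃ c : Euc N, ∫⁻ x in Ω, ENNReal.ofReal (‖gradient h x - c‖ ^ r) ≤
        ENNReal.ofReal C * (∫⁻ x in Ω, weightedHess Ω h p α x) ^ (r / p) := by
  have hr : 1 ≤ r := hp.trans hpr
  have hp0 : 0 < p := by linarith
  have hr0 : 0 < r := by linarith
  have hcos0 : 0 ≤ cos θ := cos_nonneg_of_neg_pi_div_two_le_of_le (by linarith [hθ.1, pi_pos]) hθ.2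
  have hcos1 : cos θ < 1 := by
    rw [← cos_zero]
    exact cos_lt_cos_of_nonneg_of_le_pi le_rfl (by linarith [hθ.2, pi_pos]) hθ.1
  set σ := a / 32 * (1 - cos θ) with hσdef
  have hσ : 0 < σ := mul_pos (by positivity) (by linarith)
  have hσR : σ ≤ a / 4 / 8 := by
    rw [hσdef]
    nlinarith
  obtain ⟨n₁, hn₁⟩ := exists_finset_ball_cover (E := Euc N) d (ρ := σ / 4) (by positivity)
  obtain ⟨n₂, hn₂⟩ := exists_finset_ball_cover (E := Euc N) d (ρ := a / 16) (by positivity)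
  obtain ⟨K, hK, hKb⟩ := exists_norm_fderiv_gradient_le_of_deepSet N hp hα (half_pos hσ)
  obtain ⟨D, hD, hDb⟩ := exists_lintegral_dist_mul_hessian_le N hp hpr hα hd hexp
  set v := volume.real (closedBall (0 : Euc N) d)
  have hv : 0 ≤ v := measureReal_nonneg
  set Q := r * (a / 16) / σ with hQ
  have hQ0 : 0 < Q := by positivity
  set ε := 1 / (2 * (n₂ + 1) * Q) with hε
  have hε0 : 0 < ε := by positivity
  set P := (n₁ * (K * (σ / 2))) ^ r * v with hP
  have hP0 : 0 ≤ P := by positivity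
  set X := n₂ * (P + Q * (ε ^ (1 - r) * D)) with hX
  have hX0 : 0 ≤ X := by positivity
  refine ⟨2 * X + 1, by positivity, fun Ω h hΩ hc hb hdiam hcone hh hlap hbdd => ?_⟩
  obtain ⟨L, hL⟩ := hbdd
  have hf : (frontier Ω).Nonempty := frontier_nonempty_of_isBounded hN hc.nonempty hb
  set A := ∫⁻ x in Ω, weightedHess Ω h p α x with hA
  by_cases hAtop : A = ⊤
  · refine ⟨0, ?_⟩
    rw [hAtop, ENNReal.top_rpow_of_pos (div_pos hr0 hp0), ENNReal.mul_top]
    · exact le_top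
    · rw [ne_eq, ENNReal.ofReal_eq_zero, not_le]
      positivity
  have hvol : volume Ω ≤ ENNReal.ofReal v := by
    obtain ⟨x₀, hx₀⟩ := hc.nonempty
    have hsub : Ω ⊆ closedBall x₀ d := fun x hx => (dist_le_diam_of_mem hb hx hx₀).trans hdiam
    rw [ofReal_measureReal measure_closedBall_lt_top.ne]
    refine (measure_mono hsub).trans (le_of_eq ?_)
    rw [Measure.addHaar_closedBall_center]
  have hshift : ∀ w₀ ∈ Ω, ∃ e : Euc N, ‖e‖ ≤ a / 16 ∧ InwardShift Ω (a / 4) σ w₀ e :=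
    fun w₀ hw₀ => hcone.exists_inwardShift hθ ha hΩ hf hw₀
  have ha16 : a / 4 / 4 = a / 16 := by ring
  obtain ⟨m, -, hjoin⟩ := exists_joinedIn_deepSet hσ hσR hΩ hc (by rwa [ha16])
  rw [ha16] at hjoin
  set V := gradient h with hVdef
  have hV : ContDiffOn ℝ 1 V Ω := contDiffOn_gradient hΩ hh
  set W : Euc N → Euc N := fun x => V x - V m with hW
  have hWc : ContDiffOn ℝ 1 W Ω := hV.sub contDiffOn_const
  have hWf : ∀ x, fderiv ℝ W x = fderiv ℝ V x := fun x => fderiv_sub_const _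
  set A' := A.toReal ^ (1 / p) with hA'
  have hA'0 : 0 ≤ A' := by positivity
  have hAr : ENNReal.ofReal (A' ^ r) = A ^ (r / p) := by
    rw [hA', ← rpow_mul ENNReal.toReal_nonneg, one_div_mul_eq_div,
      ← ENNReal.ofReal_rpow_of_nonneg ENNReal.toReal_nonneg (by positivity),
      ENNReal.ofReal_toReal hAtop]
  obtain ⟨T₁, hT₁, hcov₁⟩ := hn₁ Ω hb hdiam
  obtain ⟨T₂, hT₂, hcov₂⟩ := hn₂ Ω hb hdiam
  have hosc : ∀ z, JoinedIn (deepSet Ω σ) m z → ‖W z‖ ≤ n₁ * (K * (σ / 2)) * A' := by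
    intro z hz
    have h1 := norm_sub_le_of_joinedIn_deepSet hΩ hV hσ (B := K * A') (by positivity)
      (hKb Ω h hΩ hf hh hlap hAtop) hcov₁ hz
    refine h1.trans ?_
    calc (T₁.card : ℝ) * (K * A' * (σ / 2)) ≤ n₁ * (K * A' * (σ / 2)) := by gcongr
      _ = _ := by ring
  have hWr : ∫⁻ x in Ω, ENNReal.ofReal ((infDist x (frontier Ω) * ‖fderiv ℝ W x‖) ^ r) ≤
      ENNReal.ofReal D * A ^ (r / p) := by
    refine le_trans (setLIntegral_mono' hΩ.measurableSet fun x hx => ?_)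
      (hDb Ω h hΩ hf hb hdiam hh hlap)
    refine ENNReal.ofReal_le_ofReal (rpow_le_rpow (mul_nonneg infDist_nonneg (norm_nonneg _))
      (mul_le_mul_of_nonneg_left ?_ infDist_nonneg) hr0.le)
    rw [hWf]
    exact norm_fderiv_gradient_le hΩ hh hx
  set I := ∫⁻ x in Ω, ENNReal.ofReal (‖W x‖ ^ r) with hI
  have hItop : I ≠ ⊤ := by
    refine ne_top_of_le_ne_top (b := ENNReal.ofReal ((L + ‖V m‖) ^ r) * volume Ω)
      (ENNReal.mul_ne_top ENNReal.ofReal_ne_top hb.measure_lt_top.ne) ?_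
    rw [← setLIntegral_const]
    refine setLIntegral_mono' hΩ.measurableSet fun x hx => ENNReal.ofReal_le_ofReal ?_
    refine rpow_le_rpow (norm_nonneg _) ((norm_sub_le _ _).trans ?_) hr0.le
    have := hL x hx
    gcongr
  have hpatch : ∀ c ∈ T₂, ∫⁻ x in Ω ∩ ball c (a / 16), ENNReal.ofReal (‖W x‖ ^ r) ≤
      ENNReal.ofReal (P + Q * (ε ^ (1 - r) * D)) * A ^ (r / p) + ENNReal.ofReal (Q * ε) * I := by
    intro c _
    rcases (Ω ∩ ball c (a / 16)).eq_empty_or_nonempty with h0 | ⟨w₀, hw₀⟩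
    · rw [h0]
      simp
    obtain ⟨e, he, hse⟩ := hshift w₀ hw₀.1
    have hdist : ∀ x ∈ Ω ∩ ball c (a / 16), dist x w₀ < a / 4 / 2 := fun x hx => by
      have h1 : dist x c < a / 16 := hx.2
      have h2 : dist w₀ c < a / 16 := hw₀.2
      linarith [dist_triangle_right x w₀ c]
    have hdist' : ∀ x ∈ Ω ∩ ball c (a / 16), dist x w₀ < a / 4 := fun x hx =>
      (hdist x hx).trans (by linarith)
    have h1 := lintegral_norm_rpow_le_of_shift_of_forall_le hΩ hf hWc hr
      (hΩ.measurableSet.inter measurableSet_ball) inter_subset_left hσ hε0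
      (fun x hx => hosc _ (hjoin w₀ hw₀.1 e he hse x hx.1 (hdist x hx)))
      (fun w hw t ht => hse.mem hσ hw.1 (hdist' w hw) ht)
      (fun w hw t ht => hse w hw.1 (hdist' w hw) t ht)
    refine h1.trans ?_
    have hQe : r * ‖e‖ / σ ≤ Q := by
      rw [hQ]
      gcongr
    calc _ ≤ ENNReal.ofReal ((n₁ * (K * (σ / 2)) * A') ^ r) * ENNReal.ofReal v +
          ENNReal.ofReal Q * (ENNReal.ofReal ε * I +
            ENNReal.ofReal (ε ^ (1 - r)) * (ENNReal.ofReal D * A ^ (r / p))) := by gcongr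
      _ = _ := by
        rw [mul_rpow (by positivity) hA'0, ENNReal.ofReal_mul (by positivity), hAr,
          ENNReal.ofReal_add hP0 (by positivity), hP, ENNReal.ofReal_mul (by positivity),
          ENNReal.ofReal_mul hQ0.le, ENNReal.ofReal_mul (by positivity),
          ENNReal.ofReal_mul hQ0.le]
        ring
  have hsum : I ≤ ENNReal.ofReal X * A ^ (r / p) + ENNReal.ofReal (1 / 2) * I := by
    have hcovU : Ω ⊆ ⋃ c ∈ T₂, Ω ∩ ball c (a / 16) := fun x hx => by
      obtain ⟨c, hcT, hxc⟩ := mem_iUnion₂.1 (hcov₂ hx)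
      exact mem_iUnion₂.2 ⟨c, hcT, hx, hxc⟩
    calc I ≤ ∫⁻ x in ⋃ c ∈ T₂, Ω ∩ ball c (a / 16), ENNReal.ofReal (‖W x‖ ^ r) :=
          lintegral_mono_set hcovU
      _ ≤ ∑ c ∈ T₂, ∫⁻ x in Ω ∩ ball c (a / 16), ENNReal.ofReal (‖W x‖ ^ r) :=
          lintegral_finset_biUnion_le _ _ _
      _ ≤ ∑ c ∈ T₂, (ENNReal.ofReal (P + Q * (ε ^ (1 - r) * D)) * A ^ (r / p) +
          ENNReal.ofReal (Q * ε) * I) := Finset.sum_le_sum hpatch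
      _ ≤ n₂ * (ENNReal.ofReal (P + Q * (ε ^ (1 - r) * D)) * A ^ (r / p) +
          ENNReal.ofReal (Q * ε) * I) := by
          rw [Finset.sum_const, nsmul_eq_mul]
          gcongr
      _ = ENNReal.ofReal X * A ^ (r / p) + ENNReal.ofReal (n₂ * (Q * ε)) * I := by
          rw [hX, ENNReal.ofReal_mul (p := n₂) (by positivity),
            ENNReal.ofReal_mul (p := n₂) (by positivity), ENNReal.ofReal_natCast]
          ring
      _ ≤ _ := by
          gcongr
          rw [hε]
          field_simp
          linarith
  refine ⟨V m, (le_two_mul_of_le_add_half hItop hsum).trans ?_⟩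
  rw [← mul_assoc]
  gcongr
  rw [← ENNReal.ofReal_ofNat 2, ← ENNReal.ofReal_mul (by norm_num)]
  exact ENNReal.ofReal_le_ofReal (by linarith)

end Assembly

section DistanceMinusTorsion

variable {N : ℕ} {Ω : Set (Euc N)}

lemma hasFDerivAt_norm_sub_sq_div_two (x z : Euc N) :
    HasFDerivAt (fun y : Euc N => ‖y - z‖ ^ 2 / 2) (innerSL ℝ (x - z)) x := by
  have h := ((hasFDerivAt_id x).sub_const z).norm_sq.mul_const (2⁻¹ : ℝ)
  refine (h.congr_fderiv ?_).congr_of_eventuallyEq (Filter.Eventually.of_forall fun y => ?_)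
  · ext v
    simp
  · simp [div_eq_mul_inv]

lemma contDiffOn_norm_sub_sq_sub {u : Euc N → ℝ} (hu : ContDiffOn ℝ 2 u Ω) (z : Euc N) :
    ContDiffOn ℝ 2 (fun x => ‖x - z‖ ^ 2 / 2 - u x) Ω :=
  (((contDiff_id.sub contDiff_const).norm_sq ℝ).div_const 2).contDiffOn.sub hu

lemma fderiv_norm_sub_sq_sub {u : Euc N → ℝ} (hΩ : IsOpen Ω) (hu : ContDiffOn ℝ 2 u Ω)
    (z : Euc N) {x : Euc N} (hx : x ∈ Ω) :
    fderiv ℝ (fun x => ‖x - z‖ ^ 2 / 2 - u x) x = innerSL ℝ (x - z) - fderiv ℝ u x :=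
  ((hasFDerivAt_norm_sub_sq_div_two x z).sub ((hu.contDiffAt
    (hΩ.mem_nhds hx)).differentiableAt two_ne_zero).hasFDerivAt).fderiv

lemma gradient_norm_sub_sq_sub {u : Euc N → ℝ} (hΩ : IsOpen Ω) (hu : ContDiffOn ℝ 2 u Ω)
    (z : Euc N) {x : Euc N} (hx : x ∈ Ω) :
    gradient (fun x => ‖x - z‖ ^ 2 / 2 - u x) x = x - z - gradient u x := by
  ext j
  rw [gradient_apply, fderiv_norm_sub_sq_sub hΩ hu z hx, PiLp.sub_apply, gradient_apply,
    ← inner_single_eq]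
  rfl

lemma hessEntry_norm_sub_sq_sub {u : Euc N → ℝ} (hΩ : IsOpen Ω) (hu : ContDiffOn ℝ 2 u Ω)
    (z : Euc N) {x : Euc N} (hx : x ∈ Ω) (i j : Fin N) :
    hessEntry (fun x => ‖x - z‖ ^ 2 / 2 - u x) x i j =
      (EuclideanSpace.single i (1 : ℝ) : Euc N) j - hessEntry u x i j := by
  have hev : (fun y => fderiv ℝ (fun x => ‖x - z‖ ^ 2 / 2 - u x) y
      (EuclideanSpace.single j (1 : ℝ))) =ᶠ[nhds x] fun y =>
      (EuclideanSpace.proj (𝕜 := ℝ) j : Euc N →L[ℝ] ℝ) (y - z) -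
        fderiv ℝ u y (EuclideanSpace.single j (1 : ℝ)) := by
    filter_upwards [hΩ.mem_nhds hx] with y hy
    rw [fderiv_norm_sub_sq_sub hΩ hu z hy]
    exact congrArg (· - _) (inner_single_eq (y - z) j)
  have h1 := (((EuclideanSpace.proj (𝕜 := ℝ) j : Euc N →L[ℝ] ℝ).hasFDerivAt.comp x
    ((hasFDerivAt_id x).sub_const z)).sub (((contDiffOn_fderiv_apply hΩ hu
      (EuclideanSpace.single j (1 : ℝ))).contDiffAt (hΩ.mem_nhds hx)).differentiableAt
        one_ne_zero).hasFDerivAt).fderiv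
  rw [hessEntry, hev.fderiv_eq]
  exact congrArg (fun L => L (EuclideanSpace.single i (1 : ℝ))) h1

lemma lap_norm_sub_sq_sub {u : Euc N → ℝ} (hΩ : IsOpen Ω) (hu : ContDiffOn ℝ 2 u Ω)
    (z : Euc N) {x : Euc N} (hx : x ∈ Ω) :
    lap (fun x => ‖x - z‖ ^ 2 / 2 - u x) x = N - lap u x := by
  simp only [lap, hessEntry_norm_sub_sq_sub hΩ hu z hx]
  simp

lemma setIntegral_sub_average_eq_zero (hb : Bornology.IsBounded Ω) (hpos : volume Ω ≠ 0) :
    ∫ x in Ω, (x - ⨍ y in Ω, y) = 0 := by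
  have hfin : IsFiniteMeasure (volume.restrict Ω) := ⟨by simpa using hb.measure_lt_top⟩
  have : NeZero (volume.restrict Ω) := ⟨by simpa using hpos⟩
  exact integral_sub_average _ _

end DistanceMinusTorsion

/-- strengthened weighted Poincaré-type inequality for `∇h` under the
uniform interior cone condition. -/
theorem stmt_7 (N : ℕ) (hN : 2 ≤ N) (θ a d r p α : ℝ) (hθ : θ ∈ Ioc (0:ℝ) (π / 2))
    (ha : 0 < a) (hd : 0 < d) (hp1 : 1 ≤ p) (hpr : p ≤ r)
    (hrle : r ≤ N * p / (N - p * (1 - α))) (hpN : p * (1 - α) < N)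
    (hα0 : 0 ≤ α) (hα1 : α ≤ 1) :
    ∃ C > (0:ℝ), ∀ Ω : Set (Euc N), IsOpen Ω → IsConnected Ω → Bornology.IsBounded Ω →
      Metric.diam Ω ≤ d → UnifConeCond θ a Ω →
      ∀ u : Euc N → ℝ, IsTorsion Ω u →
      ∀ g : Euc N → Euc N, ContinuousOn g (closure Ω) → (∀ x ∈ Ω, g x = gradient u x) →
      ∀ z : Euc N, z = (⨍ x in Ω, x) →
      ∀ h : Euc N → ℝ, h = (fun x => ‖x - z‖ ^ 2 / 2 - u x) →
      (∫⁻ x in Ω, ENNReal.ofReal (‖gradient h x‖ ^ r)) ^ (1 / r) ≤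
        ENNReal.ofReal C *
          (∫⁻ x in Ω,
              ENNReal.ofReal (infDist x (frontier Ω) ^ (α * p) * Real.sqrt (hessNormSq h x) ^ p))
            ^ (1 / p) := by
  have hr : 1 ≤ r := hp1.trans hpr
  have hr0 : 0 < r := by linarith
  have hp0 : 0 < p := by linarith
  have hexp : r * (N - p * (1 - α)) ≤ N * p := (le_div_iff₀ (by linarith)).1 hrle
  obtain ⟨C, hC, hmain⟩ := exists_lintegral_gradient_sub_le N hN hθ ha hd hp1 hpr hα0 hexp
  refine ⟨(2 ^ r * C) ^ (1 / r), by positivity, ?_⟩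
  rintro Ω hΩ hc hb hdiam hcone u ⟨huc, hu, hlap, hu0⟩ g hg hgu z hz h rfl
  have hf : (frontier Ω).Nonempty := frontier_nonempty_of_isBounded hN hc.nonempty hb
  have hfin : IsFiniteMeasure (volume.restrict Ω) := ⟨by simpa using hb.measure_lt_top⟩
  have hh := contDiffOn_norm_sub_sq_sub hu z
  have hgrad : ∀ x ∈ Ω, gradient (fun x => ‖x - z‖ ^ 2 / 2 - u x) x = x - z - g x := fun x hx => by
    rw [gradient_norm_sub_sq_sub hΩ hu z hx, hgu x hx]
  have hcpt : IsCompact (closure Ω) := hb.isCompact_closure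
  obtain ⟨L, hL⟩ := hcpt.exists_bound_of_continuousOn
    (f := fun x => x - z - g x) ((continuousOn_id.sub continuousOn_const).sub hg)
  obtain ⟨M, hM⟩ := hcpt.exists_bound_of_continuousOn hg
  have hgint : IntegrableOn g Ω := (hg.integrableOn_compact hcpt).mono_set subset_closure
  have hxint : IntegrableOn (fun x => x - z) Ω :=
    ((continuousOn_id.sub continuousOn_const).integrableOn_compact hcpt).mono_set subset_closure
  have hg0 : ∫ x in Ω, g x = 0 := by
    have hnorm : ∀ x ∈ Ω, ‖fderiv ℝ u x‖ ≤ M := fun x hx => by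
      have h1 := hM x (subset_closure hx)
      rwa [hgu x hx, gradient, LinearIsometryEquiv.norm_map] at h1
    ext j
    have h1 := (EuclideanSpace.proj (𝕜 := ℝ) j : Euc N →L[ℝ] ℝ).integral_comp_comm hgint
    rw [PiLp.zero_apply, ← setIntegral_fderiv_apply_eq_zero hΩ hb hf huc
      (hu.differentiableOn two_ne_zero) hu0 hnorm (EuclideanSpace.single j (1 : ℝ))]
    refine h1.symm.trans (setIntegral_congr_fun hΩ.measurableSet fun x hx => ?_)
    rw [← gradient_apply, ← hgu x hx]
    rfl
  have hmean : ∫ x in Ω, (x - z - g x) = 0 := by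
    rw [integral_sub hxint hgint, hg0, hz,
      setIntegral_sub_average_eq_zero hb (hΩ.measure_pos volume hc.nonempty).ne', sub_zero]
  obtain ⟨c, hc'⟩ := hmain Ω _ hΩ hc hb hdiam hcone hh
    (fun x hx => by rw [lap_norm_sub_sq_sub hΩ hu z hx, hlap x hx, sub_self])
    ⟨L, fun x hx => by rw [hgrad x hx]; exact hL x (subset_closure hx)⟩
  have hpow : ∀ y : Euc N, ENNReal.ofReal (‖y‖ ^ r) = ‖y‖ₑ ^ r := fun y => by
    rw [← ENNReal.ofReal_rpow_of_nonneg (norm_nonneg _) hr0.le, ofReal_norm]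
  have hkey := lintegral_enorm_rpow_le_of_integral_eq_zero (hxint.sub hgint) hmean hr c
  have hbound : ∫⁻ x in Ω, ENNReal.ofReal (‖gradient (fun x => ‖x - z‖ ^ 2 / 2 - u x) x‖ ^ r) ≤
      ENNReal.ofReal (2 ^ r * C) * (∫⁻ x in Ω,
        weightedHess Ω (fun x => ‖x - z‖ ^ 2 / 2 - u x) p α x) ^ (r / p) := by
    rw [ENNReal.ofReal_mul (by positivity), mul_assoc,
      ← ENNReal.ofReal_rpow_of_pos two_pos, ENNReal.ofReal_ofNat]
    refine le_trans (le_of_eq ?_) (hkey.trans (mul_le_mul_right (le_trans (le_of_eq ?_) hc') _))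
    · refine setLIntegral_congr_fun hΩ.measurableSet fun x hx => ?_
      simp only [hpow, hgrad x hx, Pi.sub_apply]
    · refine setLIntegral_congr_fun hΩ.measurableSet fun x hx => ?_
      simp only [hpow, hgrad x hx, Pi.sub_apply]
  refine (ENNReal.rpow_le_rpow hbound (one_div_nonneg.2 hr0.le)).trans (le_of_eq ?_)
  rw [ENNReal.mul_rpow_of_nonneg _ _ (one_div_nonneg.2 hr0.le), ← ENNReal.rpow_mul,
    ENNReal.ofReal_rpow_of_nonneg (by positivity) (one_div_nonneg.2 hr0.le)]
  congr 2
  field_simp
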